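/- arXiv:2301.08976 — 3 statements merged into one kernel-verified Lean document; each statement's English description precedes it below -/
import Mathlib

section
/- For every odd positive integer k with k ≥ 2 and d = 2k − 3, the multiset over Z_2^d of length 2d + 2 consisting of the elements 0, e_1, e_2, ..., e_{d-1}, e_1 + e_2 + ... + e_{d-1}, e_d, e_d + e_1, e_d + e_2, ..., e_d + e_{d-1}, and e_d + e_1 + e_2 + ... + e_{d-1}, is a zero-sum sequence that contains no zero-sum subsequence of length 2k. -/
theorem exists_map_of_le_map {α β : Type*} (f : α → β) (S : Multiset α) :
    ∀ T : Multiset β, T ≤ S.map f → ∃ U ≤ S, U.map f = T := by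
  classical
  induction S using Multiset.induction_on with
  | empty => intro T hT; exact ⟨0, le_rfl, by rw [Multiset.map_zero] at hT ⊢; exact (Multiset.le_zero.1 hT).symm⟩
  | cons a S ih =>
    intro T hT
    rw [Multiset.map_cons] at hT
    by_cases h : f a ∈ T
    · obtain ⟨T', rfl⟩ := Multiset.exists_cons_of_mem h
      obtain ⟨U, hU, rfl⟩ := ih T' ((Multiset.cons_le_cons_iff _).1 hT)
      exact ⟨a ::ₘ U, (Multiset.cons_le_cons_iff _).2 hU, by simp⟩
    · obtain ⟨U, hU, rfl⟩ := ih T ((Multiset.le_cons_of_notMem h).1 hT)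
      exact ⟨U, hU.trans (Multiset.le_cons_self _ _), rfl⟩

def gEl {d : ℕ} (last : Fin d) : Option (Fin d) → (Fin d → ZMod 2)
  | none => 0
  | some j => if j = last then ∑ j ∈ Finset.univ.erase last, Pi.single j 1 else Pi.single j 1

def fEl {d : ℕ} (last : Fin d) : Option (Fin d) ⊕ Option (Fin d) → (Fin d → ZMod 2)
  | Sum.inl o => gEl last o
  | Sum.inr o => Pi.single last 1 + gEl last o

theorem S_eq {d : ℕ} (last : Fin d) :
    ({0} + Multiset.map (fun j => Pi.single j 1) (Finset.univ.erase last).val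
        + {∑ j ∈ Finset.univ.erase last, Pi.single j 1}
        + {Pi.single last 1} + Multiset.map (fun j => Pi.single last 1 + Pi.single j 1) (Finset.univ.erase last).val
        + {Pi.single last 1 + ∑ j ∈ Finset.univ.erase last, Pi.single j 1} : Multiset (Fin d → ZMod 2))
      = Multiset.map (fEl last) Finset.univ.val := by
  have h1 : (Finset.univ : Finset (Option (Fin d) ⊕ Option (Fin d))).val
      = Multiset.map Sum.inl Finset.univ.val + Multiset.map Sum.inr Finset.univ.val := rfl
  have h2 : (Finset.univ : Finset (Option (Fin d))).val
      = none ::ₘ Multiset.map some Finset.univ.val := rfl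
  have h3 : (Finset.univ : Finset (Fin d)).val = last ::ₘ (Finset.univ.erase last).val := by
    rw [← Finset.insert_val_of_notMem (Finset.notMem_erase _ _), Finset.insert_erase (Finset.mem_univ _)]
  have h4 : Multiset.map (fun j => gEl last (some j)) (Finset.univ.erase last).val
      = Multiset.map (fun j => Pi.single j 1) (Finset.univ.erase last).val := by
    apply Multiset.map_congr rfl
    intro j hj
    have : j ≠ last := by rw [Finset.mem_val] at hj; exact (Finset.mem_erase.1 hj).1
    simp [gEl, this]
  have h5 : Multiset.map (fun j => Pi.single last 1 + gEl last (some j)) (Finset.univ.erase last).val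
      = Multiset.map (fun j => Pi.single last 1 + Pi.single j 1) (Finset.univ.erase last).val := by
    apply Multiset.map_congr rfl
    intro j hj
    have : j ≠ last := by rw [Finset.mem_val] at hj; exact (Finset.mem_erase.1 hj).1
    simp [gEl, this]
  have h6 : gEl last (some last) = ∑ j ∈ Finset.univ.erase last, Pi.single j 1 := by simp [gEl]
  have h7 : gEl last none = 0 := rfl
  rw [h1, h2, Multiset.map_cons, Multiset.map_cons, Multiset.map_map, Multiset.map_map, h3]
  simp only [Multiset.map_add, Multiset.map_cons, Multiset.map_map, Function.comp_def, fEl]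
  rw [h4, h5, h6, h7, add_zero]
  simp only [← Multiset.singleton_add]
  abel

theorem gEl_apply {d : ℕ} (last : Fin d) (o : Option (Fin d)) (j : Fin d) (hj : j ≠ last) :
    gEl last o j = (if o = some j then 1 else 0) + (if o = some last then 1 else 0) := by
  cases o with
  | none => simp [gEl]
  | some i =>
    by_cases h : i = last
    · subst h
      simp [gEl, Finset.sum_apply, Pi.single_apply, hj, hj.symm]
    · simp [gEl, h, Pi.single_apply, eq_comm (a := j)]

theorem gEl_last {d : ℕ} (last : Fin d) (o : Option (Fin d)) :
    gEl last o last = 0 := by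
  cases o with
  | none => simp [gEl]
  | some i =>
    by_cases h : i = last
    · subst h
      simp [gEl, Finset.sum_apply, Pi.single_apply]
    · simp [gEl, h, Pi.single_apply, Ne.symm h]

theorem sum_all {d : ℕ} (last : Fin d) (U : Finset (Option (Fin d) ⊕ Option (Fin d)))
    (F : Option (Fin d) ⊕ Option (Fin d) → ZMod 2) :
    ∑ x ∈ U, F x = ∑ o, ((if Sum.inl o ∈ U then F (Sum.inl o) else 0)
      + (if Sum.inr o ∈ U then F (Sum.inr o) else 0)) := by
  rw [Finset.sum_add_distrib, ← Fintype.sum_sum_type (fun x => if x ∈ U then F x else 0)]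
  simp

theorem construction_d_eq_two_k_sub_three (k : ℕ) (hk : Odd k) (hk2 : 2 ≤ k)
    (d : ℕ) (hd : d = 2 * k - 3) :
    let e : Fin d → (Fin d → ZMod 2) := fun j => Pi.single j 1
    let last : Fin d := ⟨d - 1, by omega⟩
    let S : Multiset (Fin d → ZMod 2) :=
      {0} + Multiset.map e (Finset.univ.erase last).val
        + {∑ j ∈ Finset.univ.erase last, e j}
        + {e last} + Multiset.map (fun j => e last + e j) (Finset.univ.erase last).val
        + {e last + ∑ j ∈ Finset.univ.erase last, e j}
    Multiset.card S = 2 * d + 2 ∧ S.sum = 0 ∧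
      ¬ ∃ T ≤ S, Multiset.card T = 2 * k ∧ T.sum = 0 := by
  intro e last S
  have hS : S = Multiset.map (fEl last) Finset.univ.val := S_eq last
  have two : ∀ x : ZMod 2, x + x = 0 := by decide
  have hdodd : ((d + 1 : ℕ) : ZMod 2) = 0 := by
    rw [ZMod.natCast_eq_zero_iff]; omega
  refine ⟨?_, ?_, ?_⟩
  · rw [hS, Multiset.card_map]
    change Finset.card Finset.univ = _
    simp; omega
  · rw [hS]
    change ∑ x, fEl last x = 0
    rw [Fintype.sum_sum_type, ← Finset.sum_add_distrib]
    have : ∀ o, fEl last (Sum.inl o) + fEl last (Sum.inr o) = Pi.single last 1 := by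
      intro o
      funext j
      simp only [fEl, Pi.add_apply]
      linear_combination two (gEl last o j)
    simp only [this]
    rw [Finset.sum_const, Finset.card_univ, Fintype.card_option, Fintype.card_fin,
      ← Nat.cast_smul_eq_nsmul (ZMod 2), hdodd, zero_smul]
  · rintro ⟨T, hT, hc, hs⟩
    rw [hS] at hT
    obtain ⟨U', hU, rfl⟩ := exists_map_of_le_map _ _ _ hT
    obtain ⟨U, rfl⟩ : ∃ U : Finset (Option (Fin d) ⊕ Option (Fin d)), U.val = U' :=
      ⟨⟨U', Multiset.nodup_of_le hU Finset.univ.nodup⟩, rfl⟩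
    rw [Multiset.card_map] at hc
    change U.card = _ at hc
    change ∑ x ∈ U, fEl last x = 0 at hs
    -- cardinality as a sum
    let p : Option (Fin d) → ℕ := fun o => if Sum.inl o ∈ U then 1 else 0
    let q : Option (Fin d) → ℕ := fun o => if Sum.inr o ∈ U then 1 else 0
    have hp : ∀ o, p o ≤ 1 := by intro o; simp only [p]; split_ifs <;> simp
    have hq : ∀ o, q o ≤ 1 := by intro o; simp only [q]; split_ifs <;> simp
    have hcard : ∑ o, (p o + q o) = 2 * k := by
      rw [← hc, Finset.sum_add_distrib,
        ← Fintype.sum_sum_type (fun x => if x ∈ U then 1 else 0)]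
      simp
    have hcoord : ∀ j, j ≠ last → (((p (some j) + q (some j)) + (p (some last) + q (some last)) : ℕ) : ZMod 2) = 0 := by
      intro j hj
      have h := congrFun hs j
      rw [Finset.sum_apply, sum_all last] at h
      have : ∀ o, ((if Sum.inl o ∈ U then fEl last (Sum.inl o) j else 0)
          + (if Sum.inr o ∈ U then fEl last (Sum.inr o) j else 0) : ZMod 2)
          = (if o = some j then ((p o + q o : ℕ) : ZMod 2) else 0)
            + (if o = some last then ((p o + q o : ℕ) : ZMod 2) else 0) := by
        intro o
        simp only [fEl, Pi.add_apply, gEl_apply last o j hj, Pi.single_apply, if_neg hj, p, q]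
        split_ifs <;> push_cast <;> ring
      simp only [this] at h
      rw [Finset.sum_add_distrib] at h
      simp only [Finset.sum_ite_eq', Finset.mem_univ, if_true] at h
      push_cast at h ⊢
      simpa using h
    have hlast : ((∑ o, q o : ℕ) : ZMod 2) = 0 := by
      have h := congrFun hs last
      rw [Finset.sum_apply, sum_all last] at h
      rw [Nat.cast_sum]
      rw [Pi.zero_apply] at h
      rw [← h]
      apply Finset.sum_congr rfl
      intro o _
      simp only [fEl, Pi.add_apply, gEl_last, q]
      split_ifs <;> simp
    rw [ZMod.natCast_eq_zero_iff] at hlast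
    simp only [ZMod.natCast_eq_zero_iff] at hcoord
    rw [Fintype.sum_option] at hcard
    have b1 := hp none
    have b2 := hq none
    by_cases hpar : p (some last) + q (some last) = 1
    · have hall : ∀ j, p (some j) + q (some j) = 1 := by
        intro j
        by_cases hj : j = last
        · rw [hj, hpar]
        · have := hcoord j hj
          have := hp (some j)
          have := hq (some j)
          omega
      simp only [hall] at hcard
      simp at hcard
      omega
    · have hall : ∀ j, p (some j) = q (some j) := by
        intro j
        have := hp (some j)
        have := hq (some j)
        have := hp (some last)
        have := hq (some last)
        by_cases hj : j = last
        · subst hj; omega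
        · have := hcoord j hj
          omega
      rw [Fintype.sum_option] at hlast
      simp only [hall, ← two_mul] at hcard
      rw [← Finset.mul_sum] at hcard
      obtain ⟨m, hm⟩ := hk
      omega
end

section
/- For every positive integer k, every zero-sum sequence of length 4k − 2 over Z_2^{2k-1} contains a zero-sum subsequence of length 2k. That is, if x_2, x_3, ..., x_{4k-1} are elements of Z_2^{2k-1} with x_2 + x_3 + ... + x_{4k-1} = 0, then there is a subset of 2k of these elements (counted with multiplicity) summing to zero. -/
open Finset in
/-- A system of disjoint pairs `(i, b i)`, `i ∈ I`, with independent differences. -/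
def PairSys {ι V : Type*} [AddCommGroup V] [Module (ZMod 2) V] (x : ι → V) (I : Finset ι)
    (b : ι → ι) : Prop :=
  Set.InjOn b (I : Set ι) ∧ (∀ i ∈ I, b i ∉ I) ∧
    LinearIndepOn (ZMod 2) (fun i => x i + x (b i)) (I : Set ι)

lemma zz_eq_of_add {V : Type*} [AddCommGroup V] [Module (ZMod 2) V] (u v : V) :
    u + v + v = u := by
  rw [add_assoc, ZModModule.add_self, add_zero]

lemma zz_exists_subset {ι V : Type*} [DecidableEq ι] [AddCommGroup V] [Module (ZMod 2) V]
    (d : ι → V) (I : Finset ι) (v : V) (hv : v ∈ Submodule.span (ZMod 2) (d '' (I : Set ι))) :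
    ∃ P ⊆ I, ∑ i ∈ P, d i = v := by
  classical
  rw [Submodule.mem_span_image_finset_iff_exists_fun] at hv
  obtain ⟨c, hc⟩ := hv
  refine ⟨I.filter (fun i => ∃ h : i ∈ I, c ⟨i, h⟩ = 1), Finset.filter_subset _ _, ?_⟩
  rw [← hc, Finset.sum_filter, ← Finset.sum_coe_sort]
  refine Finset.sum_congr rfl fun i _ => ?_
  have : ∀ z : ZMod 2, z = 0 ∨ z = 1 := by decide
  rcases this (c i) with h | h <;> simp [h]

lemma zz_select {ι V : Type*} [DecidableEq ι] [AddCommGroup V] [Module (ZMod 2) V]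
    {x : ι → V} {I : Finset ι} {b : ι → ι} (h : PairSys x I b) (I' : Finset ι) (hI : I' ⊆ I)
    (v : V) (hv : v ∈ Submodule.span (ZMod 2) ((fun i => x i + x (b i)) '' (I' : Set ι))) :
    ∃ A ⊆ I' ∪ I'.image b, A.card = I'.card ∧ ∑ i ∈ A, x i = ∑ i ∈ I', x i + v := by
  obtain ⟨P, hP, hs⟩ := zz_exists_subset _ _ _ hv
  have hinj : Set.InjOn (fun i => if i ∈ P then b i else i) (I' : Set ι) := by
    intro i hi j hj hij
    have h1 := h.1 (hI hi) (hI hj)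
    have h2 := h.2.1 i (hI hi)
    have h3 := h.2.1 j (hI hj)
    have hi' := hI hi
    have hj' := hI hj
    simp only at hij
    split_ifs at hij with ha hb hb
    · exact h1 hij
    · rw [hij] at h2; exact absurd hj' h2
    · rw [← hij] at h3; exact absurd hi' h3
    · exact hij
  refine ⟨I'.image (fun i => if i ∈ P then b i else i), ?_, Finset.card_image_of_injOn hinj, ?_⟩
  · intro z hz
    obtain ⟨i, hi, rfl⟩ := Finset.mem_image.1 hz
    split_ifs
    · exact Finset.mem_union_right _ (Finset.mem_image_of_mem _ hi)
    · exact Finset.mem_union_left _ hi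
  · rw [Finset.sum_image hinj, ← hs]
    have e : ∑ i ∈ P, (x i + x (b i)) = ∑ i ∈ I', if i ∈ P then x i + x (b i) else 0 := by
      rw [← Finset.sum_filter, Finset.filter_mem_eq_inter, Finset.inter_eq_right.2 hP]
    rw [e, ← Finset.sum_add_distrib]
    refine Finset.sum_congr rfl fun i _ => ?_
    split_ifs
    · rw [← add_assoc, ZModModule.add_self, zero_add]
    · simp

/-- The elements outside a maximal system are congruent modulo the span. -/
lemma zz_max {ι V : Type*} [DecidableEq ι] [AddCommGroup V] [Module (ZMod 2) V]
    {x : ι → V} {I : Finset ι} {b : ι → ι} (h : PairSys x I b)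
    (hmax : ∀ J b', PairSys x J b' → J.card ≤ I.card) (c e : ι) (hce : c ≠ e)
    (hc : c ∉ I ∪ I.image b) (he : e ∉ I ∪ I.image b) :
    x c + x e ∈ Submodule.span (ZMod 2) ((fun i => x i + x (b i)) '' (I : Set ι)) := by
  by_contra hn
  simp only [Finset.mem_union, Finset.mem_image, not_or, not_exists, not_and] at hc he
  have hne : ∀ i ∈ I, i ≠ c := fun i hi hic => hc.1 (hic ▸ hi)
  have hup : ∀ i ∈ I, Function.update b c e i = b i := fun i hi =>
    Function.update_of_ne (hne i hi) _ _
  have key : PairSys x (insert c I) (Function.update b c e) := by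
    refine ⟨?_, ?_, ?_⟩
    · rw [Finset.coe_insert, Set.injOn_insert (by simpa using hc.1)]
      refine ⟨?_, ?_⟩
      · intro i hi j hj hij
        rw [hup i hi, hup j hj] at hij
        exact h.1 hi hj hij
      · rintro ⟨i, hi, hie⟩
        rw [hup i hi, Function.update_self] at hie
        exact he.2 i hi hie
    · intro i hi
      rcases Finset.mem_insert.1 hi with rfl | hi
      · simp [he.1, hce.symm]
      · rw [hup i hi, Finset.mem_insert, not_or]
        exact ⟨hc.2 i hi, h.2.1 i hi⟩
    · have hE : Set.EqOn (fun i => x i + x (b i))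
          (fun i => x i + x (Function.update b c e i)) (I : Set ι) := by
        intro i hi
        simp only [hup i hi]
      rw [Finset.coe_insert, linearIndepOn_insert (by simpa using hc.1)]
      refine ⟨h.2.2.congr hE, ?_⟩
      rw [← hE.image_eq]
      simpa using hn
  have := hmax _ _ key
  rw [Finset.card_insert_of_notMem hc.1] at this
  omega

/-- Exchange step. -/
lemma zz_exchange {ι V : Type*} [DecidableEq ι] [AddCommGroup V] [Module (ZMod 2) V]
    {x : ι → V} {I : Finset ι} {b : ι → ι} (h : PairSys x I b)
    (hmax : ∀ J b', PairSys x J b' → J.card ≤ I.card) (c e i : ι) (hce : c ≠ e)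
    (hc : c ∉ I ∪ I.image b) (he : e ∉ I ∪ I.image b) (hi : i ∈ I)
    (hout : x i + x c ∉ Submodule.span (ZMod 2) ((fun i => x i + x (b i)) '' (I : Set ι))) :
    x i + x (b i) + (x c + x e) ∈
      Submodule.span (ZMod 2) ((fun i => x i + x (b i)) '' ((I.erase i : Finset ι) : Set ι)) := by
  have hceW := zz_max h hmax c e hce hc he
  have hc0 := hc
  have he0 := he
  simp only [Finset.mem_union, Finset.mem_image, not_or, not_exists, not_and] at hc he
  have hup : ∀ j ∈ I.erase i, Function.update b i c j = b j := fun j hj =>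
    Function.update_of_ne (Finset.ne_of_mem_erase hj) _ _
  have hE : Set.EqOn (fun j => x j + x (b j))
      (fun j => x j + x (Function.update b i c j)) ((I.erase i : Finset ι) : Set ι) := by
    intro j hj
    simp only [hup j hj]
  have hIi : (I : Set ι) = insert i ((I.erase i : Finset ι) : Set ι) := by
    rw [← Finset.coe_insert, Finset.insert_erase hi]
  have hsub : ((I.erase i : Finset ι) : Set ι) ⊆ I := by
    exact_mod_cast Finset.erase_subset i I
  have hmono := Submodule.span_mono (R := ZMod 2)
    (Set.image_mono (f := fun j => x j + x (b j)) hsub)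
  have key : PairSys x I (Function.update b i c) := by
    refine ⟨?_, ?_, ?_⟩
    · rw [hIi, Set.injOn_insert (by simp)]
      refine ⟨?_, ?_⟩
      · intro j hj l hl hij
        rw [hup j hj, hup l hl] at hij
        exact h.1 (hsub hj) (hsub hl) hij
      · rintro ⟨j, hj, hje⟩
        rw [hup j hj, Function.update_self] at hje
        exact hc.2 j (hsub hj) hje
    · intro j hj
      by_cases hji : j = i
      · subst hji; simpa using hc.1
      · rw [Function.update_of_ne hji]; exact h.2.1 j hj
    · rw [hIi, linearIndepOn_insert (by simp)]
      refine ⟨(h.2.2.mono hsub).congr hE, ?_⟩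
      rw [← hE.image_eq]
      simp only [Function.update_self]
      exact fun hh => hout (hmono hh)
  have hbi : b i ∉ I ∪ I.image (Function.update b i c) := by
    simp only [Finset.mem_union, Finset.mem_image, not_or, not_exists, not_and]
    refine ⟨h.2.1 i hi, fun j hj hjb => ?_⟩
    by_cases hji : j = i
    · subst hji
      rw [Function.update_self] at hjb
      exact hc.2 j hj hjb.symm
    · rw [Function.update_of_ne hji] at hjb
      exact hji (h.1 hj hi hjb)
  have hee : e ∉ I ∪ I.image (Function.update b i c) := by
    simp only [Finset.mem_union, Finset.mem_image, not_or, not_exists, not_and]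
    refine ⟨he.1, fun j hj hjb => ?_⟩
    by_cases hji : j = i
    · subst hji
      rw [Function.update_self] at hjb
      exact hce hjb
    · rw [Function.update_of_ne hji] at hjb
      exact he.2 j hj hjb
  have hfin := zz_max key hmax (b i) e (he.2 i hi) hbi hee
  rw [hIi, Set.image_insert_eq, ← hE.image_eq, Submodule.mem_span_insert] at hfin
  obtain ⟨α, z, hz, hα⟩ := hfin
  simp only [Function.update_self] at hα
  have h01 : ∀ z : ZMod 2, z = 0 ∨ z = 1 := by decide
  rcases h01 α with rfl | rfl
  · exfalso
    apply hout
    have hd : x i + x (b i) ∈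
        Submodule.span (ZMod 2) ((fun i => x i + x (b i)) '' (I : Set ι)) :=
      Submodule.subset_span ⟨i, hi, rfl⟩
    rw [zero_smul, zero_add] at hα
    have := Submodule.add_mem _ (Submodule.add_mem _ hd (hmono hz)) hceW
    rw [← hα] at this
    have e2 : x i + x (b i) + (x (b i) + x e) + (x c + x e)
      = x i + x c + (x (b i) + x (b i)) + (x e + x e) := by abel
    rw [e2, ZModModule.add_self, ZModModule.add_self, add_zero, add_zero] at this
    exact this
  · rw [one_smul] at hα
    have e2 : x i + x (b i) + (x c + x e) = (x i + x c) + (x (b i) + x e) := by abel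
    rw [e2, hα, ← add_assoc, ZModModule.add_self, zero_add]
    exact hz

lemma zz_core {ι V : Type*} [Fintype ι] [DecidableEq ι] [AddCommGroup V] [Module (ZMod 2) V]
    [Module.Finite (ZMod 2) V] (m : ℕ) (hm : 0 < m) (hcard : Fintype.card ι = 2 * m)
    (hrank : Module.finrank (ZMod 2) V = m) (x : ι → V) (hsum : ∑ i, x i = 0)
    (I : Finset ι) (b : ι → ι) (h : PairSys x I b)
    (hmax : ∀ J b', PairSys x J b' → J.card ≤ I.card)
    (c : ι) (hc : c ∉ I ∪ I.image b) (hxc : x c = 0) :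
    ∃ A : Finset ι, A.card = m + 1 ∧ ∑ i ∈ A, x i = 0 := by
  set W := Submodule.span (ZMod 2) ((fun i => x i + x (b i)) '' (I : Set ι)) with hW
  have hdisj : Disjoint I (I.image b) := by
    rw [Finset.disjoint_left]
    intro i hi hi'
    obtain ⟨j, hj, rfl⟩ := Finset.mem_image.1 hi'
    exact h.2.1 j hj hi
  have hUcard : (I ∪ I.image b).card = 2 * I.card := by
    rw [Finset.card_union_of_disjoint hdisj, Finset.card_image_of_injOn h.1]; omega
  set R := (I ∪ I.image b)ᶜ with hR
  have hRcard : R.card = 2 * m - 2 * I.card := by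
    rw [hR, Finset.card_compl, hUcard, hcard]
  have hcR : c ∈ R := by simpa [hR] using hc
  have hRpos : 0 < R.card := Finset.card_pos.2 ⟨c, hcR⟩
  have hmemR : ∀ e ∈ R, e ∉ I ∪ I.image b := fun e he => Finset.mem_compl.1 he
  have hRW : ∀ e ∈ R, x e ∈ W := by
    intro e he
    by_cases hce : c = e
    · rw [← hce, hxc]; exact W.zero_mem
    · have := zz_max h hmax c e hce hc (hmemR e he)
      rwa [hxc, zero_add] at this
  have hdW : ∀ i ∈ I, x i + x (b i) ∈ W := fun i hi => Submodule.subset_span ⟨i, hi, rfl⟩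
  have hdH : ∀ i ∈ I, x i + x (b i) ∉ Submodule.span (ZMod 2)
      ((fun i => x i + x (b i)) '' ((I.erase i : Finset ι) : Set ι)) := by
    intro i hi
    have := h.2.2
    rw [← Finset.insert_erase hi, Finset.coe_insert, linearIndepOn_insert (by simp)] at this
    exact this.2
  by_cases ht : I.card + 2 ≤ m
  · -- everything lies in `W`
    have hIW : ∀ i ∈ I, x i ∈ W := by
      intro i hi
      by_contra hiW
      have h3 : 2 < R.card := by omega
      obtain ⟨e, he, f, hf, hec, hfc, hef⟩ : ∃ e ∈ R, ∃ f ∈ R, c ≠ e ∧ c ≠ f ∧ e ≠ f := by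
        have h2 : 1 < (R.erase c).card := by rw [Finset.card_erase_of_mem hcR]; omega
        obtain ⟨e, he, f, hf, hef⟩ := Finset.one_lt_card.1 h2
        exact ⟨e, Finset.mem_of_mem_erase he, f, Finset.mem_of_mem_erase hf,
          (Finset.ne_of_mem_erase he).symm, (Finset.ne_of_mem_erase hf).symm, hef⟩
      have hout : ∀ g ∈ R, x i + x g ∉ W := by
        intro g hg hh
        exact hiW (by simpa using W.sub_mem hh (hRW g hg))
      have a1 := zz_exchange h hmax c e i hec hc (hmemR e he) hi (hout c hcR)
      have a2 := zz_exchange h hmax c f i hfc hc (hmemR f hf) hi (hout c hcR)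
      have a3 := zz_exchange h hmax e f i hef (hmemR e he) (hmemR f hf) hi (hout e he)
      have := Submodule.add_mem _ (Submodule.add_mem _ a1 a2) a3
      apply hdH i hi
      rw [hxc] at this
      generalize x i + x (b i) = d at this ⊢
      have e2 : d + (0 + x e) + (d + (0 + x f)) + (d + (x e + x f))
        = d + (d + d) + (x e + x e) + (x f + x f) := by abel
      rw [e2, ZModModule.add_self, ZModModule.add_self, ZModModule.add_self] at this
      simpa using this
    obtain ⟨B, hBR, hB⟩ := Finset.exists_subset_card_eq (s := R) (n := m + 1 - I.card) (by omega)
    have hv : ∑ i ∈ I, x i + ∑ i ∈ B, x i ∈ W :=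
      W.add_mem (W.sum_mem hIW) (W.sum_mem fun i hi => hRW i (hBR hi))
    obtain ⟨A, hA, hAc, hAs⟩ := zz_select h I subset_rfl _ hv
    have hAB : Disjoint A B :=
      Finset.disjoint_of_subset_left hA (Finset.disjoint_of_subset_right hBR disjoint_compl_right)
    refine ⟨A ∪ B, ?_, ?_⟩
    · rw [Finset.card_union_of_disjoint hAB, hAc, hB]; omega
    · rw [Finset.sum_union hAB, hAs, ← add_assoc, ZModModule.add_self, zero_add,
        ZModModule.add_self]
  · have htm : I.card + 1 = m := by omega
    have hR2 : (R.erase c).card = 1 := by rw [Finset.card_erase_of_mem hcR]; omega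
    obtain ⟨e, hRe⟩ := Finset.card_eq_one.1 hR2
    have heR' : e ∈ R.erase c := by rw [hRe]; simp
    have heR : e ∈ R := Finset.mem_of_mem_erase heR'
    have hec : e ≠ c := Finset.ne_of_mem_erase heR'
    have hRs : ∑ i ∈ R, x i = x e := by
      rw [← Finset.add_sum_erase R x hcR, hRe, hxc]; simp
    have hxe : ∑ i ∈ I, (x i + x (b i)) = x e := by
      have h1 := Finset.sum_add_sum_compl (I ∪ I.image b) x
      rw [hsum, ← hR, hRs, Finset.sum_union hdisj, Finset.sum_image h.1,
        ← Finset.sum_add_distrib] at h1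
      rw [← zz_eq_of_add (∑ i ∈ I, (x i + x (b i))) (x e), h1, zero_add]
    -- a functional with kernel `W`
    have hWr : Module.finrank (ZMod 2) W = I.card := by
      have h1 := h.2.2
      have h2 := finrank_span_eq_card (R := ZMod 2) h1
      have h4 : Fintype.card ((I : Set ι) : Type _) = I.card := by simp
      rw [h4] at h2
      rw [← h2, hW, Set.image_eq_range]
    obtain ⟨φ, hφ⟩ : ∃ φ : V →ₗ[ZMod 2] ZMod 2, LinearMap.ker φ = W := by
      have hne : ∃ u, u ∉ W := by
        by_contra hall
        push Not at hall
        have : W = ⊤ := by ext u; simp [hall u]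
        rw [this, finrank_top] at hWr
        omega
      obtain ⟨u, hu⟩ := hne
      obtain ⟨φ, hφu, hφ⟩ := Submodule.exists_le_ker_of_notMem hu
      refine ⟨φ, (Submodule.eq_of_le_of_finrank_eq hφ ?_).symm⟩
      have h1 := LinearMap.finrank_range_add_finrank_ker φ
      have h2 : LinearMap.range φ = ⊤ := by
        rw [LinearMap.range_eq_top]
        exact LinearMap.surjective (fun h0 => hφu (by rw [h0]; simp))
      rw [h2, finrank_top, Module.finrank_self] at h1
      omega
    have hWφ : ∀ v, v ∈ W ↔ φ v = 0 := fun v => by rw [← hφ, LinearMap.mem_ker]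
    have h01 : ∀ z : ZMod 2, z = 0 ∨ z = 1 := by decide
    by_cases hpar : φ (∑ i ∈ I, x i) = 0
    · have hv : ∑ i ∈ I, x i + ∑ i ∈ R, x i ∈ W :=
        W.add_mem ((hWφ _).2 hpar) (W.sum_mem hRW)
      obtain ⟨A, hA, hAc, hAs⟩ := zz_select h I subset_rfl _ hv
      have hAB : Disjoint A R := Finset.disjoint_of_subset_left hA disjoint_compl_right
      refine ⟨A ∪ R, ?_, ?_⟩
      · rw [Finset.card_union_of_disjoint hAB, hAc]; omega
      · rw [Finset.sum_union hAB, hAs, ← add_assoc, ZModModule.add_self, zero_add,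
          ZModModule.add_self]
    · obtain ⟨i, hi, hφi⟩ : ∃ i ∈ I, φ (x i) ≠ 0 := by
        by_contra hall
        push Not at hall
        exact hpar (by rw [map_sum]; exact Finset.sum_eq_zero hall)
      set H := Submodule.span (ZMod 2)
        ((fun i => x i + x (b i)) '' ((I.erase i : Finset ι) : Set ι)) with hH
      have hHe : x i + x (b i) + x e ∈ H := by
        rw [← hxe, ← Finset.add_sum_erase I _ hi, ← add_assoc, ZModModule.add_self, zero_add]
        exact H.sum_mem fun j hj => Submodule.subset_span ⟨j, hj, rfl⟩
      set s := ∑ j ∈ I.erase i, x j with hs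
      have hsW : s ∈ W := by
        rw [hWφ]
        have h1 : φ (x i) = 1 := (h01 _).resolve_left hφi
        have h2 := (h01 _).resolve_left hpar
        rw [← Finset.add_sum_erase I x hi, map_add, h1] at h2
        rw [← hs] at h2
        simpa using h2
      -- one of the two leftovers works
      obtain ⟨g, hg, hgH⟩ : ∃ g ∈ R, s + (x i + x (b i) + x g) ∈ H := by
        rw [hW, ← Finset.insert_erase hi, Finset.coe_insert, Set.image_insert_eq,
          Submodule.mem_span_insert] at hsW
        obtain ⟨α, z, hz, hα⟩ := hsW
        rcases h01 α with rfl | rfl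
        · refine ⟨e, heR, H.add_mem ?_ hHe⟩
          rw [hα, zero_smul, zero_add]; exact hz
        · refine ⟨c, hcR, ?_⟩
          rw [hα, one_smul, hxc, add_zero, add_comm, ← add_assoc, ZModModule.add_self, zero_add]
          exact hz
      obtain ⟨A, hA, hAc, hAs⟩ := zz_select h (I.erase i) (Finset.erase_subset _ _) _ hgH
      have hib : i ≠ b i := fun hh => h.2.1 i hi (hh ▸ hi)
      have hgU := hmemR g hg
      simp only [Finset.mem_union, Finset.mem_image, not_or, not_exists, not_and] at hgU
      have hgi : i ≠ g := fun hh => hgU.1 (hh ▸ hi)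
      have hgb : b i ≠ g := hgU.2 i hi
      have hAB : Disjoint A {i, b i, g} := by
        refine Finset.disjoint_of_subset_left hA ?_
        rw [Finset.disjoint_right]
        intro j hj hj'
        simp only [Finset.mem_union, Finset.mem_image, Finset.mem_erase] at hj'
        simp only [Finset.mem_insert, Finset.mem_singleton] at hj
        rcases hj' with ⟨hji, hjI⟩ | ⟨l, ⟨hli, hlI⟩, rfl⟩
        · rcases hj with rfl | rfl | rfl
          · exact hji rfl
          · exact h.2.1 i hi hjI
          · exact hgU.1 hjI
        · rcases hj with hj | hj | hj
          · exact h.2.1 l hlI (hj ▸ hi)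
          · exact hli (h.1 hlI hi hj)
          · exact hgU.2 l hlI hj
      have h3 : ({i, b i, g} : Finset ι).card = 3 :=
        Finset.card_eq_three.2 ⟨i, b i, g, hib, hgi, hgb, rfl⟩
      have hIpos : 0 < I.card := Finset.card_pos.2 ⟨i, hi⟩
      refine ⟨A ∪ {i, b i, g}, ?_, ?_⟩
      · rw [Finset.card_union_of_disjoint hAB, hAc, h3, Finset.card_erase_of_mem hi]; omega
      · rw [Finset.sum_union hAB, hAs, ← add_assoc, ← hs, ZModModule.add_self, zero_add,
          Finset.sum_insert (by simp [hib, hgi]), Finset.sum_pair hgb, ← add_assoc (x i),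
          ZModModule.add_self]

lemma zz_main {ι V : Type*} [Fintype ι] [DecidableEq ι] [AddCommGroup V] [Module (ZMod 2) V]
    [Module.Finite (ZMod 2) V] (m : ℕ) (hm : 0 < m) (hodd : Even (m + 1))
    (hcard : Fintype.card ι = 2 * m)
    (hrank : Module.finrank (ZMod 2) V = m) (x : ι → V) (hsum : ∑ i, x i = 0) :
    ∃ A : Finset ι, A.card = m + 1 ∧ ∑ i ∈ A, x i = 0 := by
  classical
  have heven : ∀ (v : V) (n : ℕ), Even n → n • v = 0 := by
    rintro v n ⟨r, rfl⟩
    rw [add_smul, ZModModule.add_self]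
  obtain ⟨I, b, h, hmax⟩ : ∃ I b, PairSys x I b ∧
      ∀ J b', PairSys x J b' → J.card ≤ I.card := by
    obtain ⟨I, hI, hmax⟩ := Finset.exists_max_image
      (Finset.univ.filter fun I : Finset ι => ∃ b, PairSys x I b) Finset.card
      ⟨∅, Finset.mem_filter.2 ⟨Finset.mem_univ _, id, by simp [PairSys]⟩⟩
    obtain ⟨b, hb⟩ := (Finset.mem_filter.1 hI).2
    exact ⟨I, b, hb, fun J b' hJ => hmax J (Finset.mem_filter.2 ⟨Finset.mem_univ _, b', hJ⟩)⟩
  obtain ⟨c, hc⟩ : ∃ c, c ∉ I ∪ I.image b := by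
    by_contra hall
    push Not at hall
    have hU : I ∪ I.image b = Finset.univ := Finset.eq_univ_iff_forall.2 hall
    have hdisj : Disjoint I (I.image b) := by
      rw [Finset.disjoint_left]
      intro i hi hi'
      obtain ⟨j, hj, rfl⟩ := Finset.mem_image.1 hi'
      exact h.2.1 j hj hi
    rw [← hU, Finset.sum_union hdisj, Finset.sum_image h.1, ← Finset.sum_add_distrib] at hsum
    have hne : I.Nonempty := by
      rw [Finset.nonempty_iff_ne_empty]
      rintro rfl
      have := congrArg Finset.card hU
      simp [hcard] at this
      omega
    obtain ⟨i, hi⟩ := hne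
    have := linearIndepOn_finset_iff.1 h.2.2 (fun _ => 1) (by simpa using hsum) i hi
    exact one_ne_zero this
  have hP : ∀ J b', PairSys (fun i => x i + x c) J b' ↔ PairSys x J b' := by
    intro J b'
    have : (fun i => x i + x c + (x (b' i) + x c)) = fun i => x i + x (b' i) := by
      funext i
      rw [add_add_add_comm, ZModModule.add_self, add_zero]
    simp only [PairSys, this]
  obtain ⟨A, hA, hs⟩ := zz_core m hm hcard hrank (fun i => x i + x c)
    (by rw [Finset.sum_add_distrib, hsum, Finset.sum_const, heven, add_zero]
        rw [Finset.card_univ, hcard]; exact even_two_mul m) I b ((hP _ _).2 h)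
    (fun J b' hJ => hmax J b' ((hP _ _).1 hJ)) c hc (ZModModule.add_self _)
  refine ⟨A, hA, ?_⟩
  rwa [Finset.sum_add_distrib, Finset.sum_const, heven _ _ (hA ▸ hodd), add_zero] at hs

theorem zero_sum_subseq_d_eq_two_k_sub_one (k : ℕ) (hk : 0 < k)
    (S : Multiset (Fin (2 * k - 1) → ZMod 2))
    (hcard : Multiset.card S = 4 * k - 2) (hsum : S.sum = 0) :
    ∃ T ≤ S, Multiset.card T = 2 * k ∧ T.sum = 0 := by
  induction S using Quotient.inductionOn with
  | h l =>
  have hS : (Finset.univ : Finset (Fin l.length)).val.map l.get = (l : Multiset (Fin (2 * k - 1) → ZMod 2)) := by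
    rw [Fin.univ_val_map, List.ofFn_get]
  change Multiset.card (l : Multiset (Fin (2 * k - 1) → ZMod 2)) = _ at hcard
  change (l : Multiset (Fin (2 * k - 1) → ZMod 2)).sum = 0 at hsum
  change ∃ T ≤ (l : Multiset (Fin (2 * k - 1) → ZMod 2)), _
  obtain ⟨A, hA, hs⟩ := zz_main (2 * k - 1) (by omega) ⟨k, by omega⟩
    (by rw [Fintype.card_fin]; rw [Multiset.coe_card] at hcard; omega)
    (by simp) l.get (by rw [← hS] at hsum; exact hsum)
  refine ⟨A.val.map l.get, ?_, ?_, hs⟩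
  · rw [← hS]
    exact Multiset.map_le_map (Finset.val_le_iff.2 (Finset.subset_univ A))
  · rw [Multiset.card_map, Finset.card_val, hA]; omega
end

section
/- Let k be a positive integer and let d be an odd positive integer satisfying d ≤ 2k − 3 if k is even, and d ≤ 2k − 5 if k is odd. Then every zero-sum sequence of length 2k + d − 1 over Z_2^d contains a zero-sum subsequence of length 2k. -/
namespace ZS
variable {ι V : Type} [AddCommGroup V] [Module (ZMod 2) V]

structure Cfg (s : ι → V) (j : ℕ) where
  p : Fin j → Bool → ι
  inj : ∀ R γ R' γ', p R γ = p R' γ' → R = R' ∧ γ = γ'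
  φ : V →ₗ[ZMod 2] ZMod 2
  ψ : Fin j → V →ₗ[ZMod 2] ZMod 2
  hφ : ∀ R, φ (s (p R true)) = φ (s (p R false))
  hψ : ∀ R S, ψ R (s (p S true)) + ψ R (s (p S false)) = if R = S then 1 else 0

namespace Cfg
variable {s : ι → V} {j : ℕ}

def f (c : Cfg s j) (i : ι) : ZMod 2 := c.φ (s i)
def g (c : Cfg s j) (R : Fin j) (i : ι) : ZMod 2 := c.ψ R (s i)
def Free (c : Cfg s j) (x : ι) : Prop := ∀ R γ, c.p R γ ≠ x
def Sep (c : Cfg s j) : Prop := ∀ v, c.φ v = 0 → (∀ R, c.ψ R v = 0) → v = 0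

lemma f_p (c : Cfg s j) (R : Fin j) (γ : Bool) : c.f (c.p R γ) = c.f (c.p R true) := by
  cases γ
  · exact (c.hφ R).symm
  · rfl

lemma z2 (a : ZMod 2) : a = 0 ∨ a = 1 := by revert a; decide

lemma g_ne (c : Cfg s j) {R S : Fin j} (h : R ≠ S) (γ : Bool) :
    c.g R (c.p S γ) = c.g R (c.p S true) := by
  cases γ
  · have := c.hψ R S
    rw [if_neg h] at this
    unfold g
    generalize c.ψ R (s (c.p S true)) = a at *
    generalize c.ψ R (s (c.p S false)) = b at *
    revert a b; decide
  · rfl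

lemma g_self (c : Cfg s j) (R : Fin j) (γ : Bool) :
    c.g R (c.p R (!γ)) = c.g R (c.p R γ) + 1 := by
  have := c.hψ R R
  rw [if_pos rfl] at this
  unfold g
  cases γ <;>
  · simp only [Bool.not_true, Bool.not_false]
    generalize c.ψ R (s (c.p R true)) = a at *
    generalize c.ψ R (s (c.p R false)) = b at *
    revert a b; decide

lemma ex_beta (c : Cfg s j) (P : Fin j) (x : ι) :
    ∃ β, c.g P x = c.g P (c.p P β) + 1 := by
  have h := c.g_self P true
  rcases z2 (c.g P x + c.g P (c.p P true)) with h1 | h1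
  · refine ⟨false, ?_⟩
    simp only [Bool.not_true] at h
    rw [h]
    generalize c.g P x = a at *
    generalize c.g P (c.p P true) = b at *
    clear h; revert a b; decide
  · refine ⟨true, ?_⟩
    generalize c.g P x = a at *
    generalize c.g P (c.p P true) = b at *
    clear h; revert a b; decide

/-- Replace the end `!β` of the pair `P` by the free point `x`. -/
def move (c : Cfg s j) (P : Fin j) (β : Bool) (x : ι) (hx : c.Free x)
    (h : c.g P x = c.g P (c.p P β) + 1) : Cfg s j where
  p := fun R γ => if R = P ∧ γ = !β then x else c.p R γ
  inj := by
    intro R γ R' γ' e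
    split_ifs at e with h1 h2 h2
    · exact ⟨h1.1.trans h2.1.symm, h1.2.trans h2.2.symm⟩
    · exact absurd e.symm (hx _ _)
    · exact absurd e (hx _ _)
    · exact c.inj _ _ _ _ e
  φ := c.φ + (c.f (c.p P true) + c.f x) • c.ψ P
  ψ := fun R => if R = P then c.ψ P else c.ψ R + (c.g R (c.p P β) + c.g R x) • c.ψ P
  hφ := by
    intro R
    by_cases hR : R = P
    · subst hR
      have h1 := c.f_p R β
      unfold g at h
      unfold f at *
      cases β <;> simp at * <;> rw [h]
      · generalize c.φ (s x) = a at *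
        rw [h1]
        generalize c.φ (s (c.p R true)) = b at *
        generalize c.ψ R (s (c.p R false)) = d at *
        clear h h1; revert a b d; decide
      · generalize c.φ (s x) = a at *
        generalize c.φ (s (c.p R true)) = b at *
        generalize c.ψ R (s (c.p R true)) = d at *
        clear h h1; revert a b d; decide
    · have h1 := c.g_ne (Ne.symm hR) false
      have h2 := c.hφ R
      unfold g at h1
      simp [hR, h1, h2]
  hψ := by
    intro R S
    by_cases hS : S = P
    · subst hS
      by_cases hR : R = S
      · subst hR
        unfold g at h
        cases β <;> simp [h] <;>
        · generalize c.ψ R _ = a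
          revert a; decide
      · have h1 := c.g_ne hR β
        unfold g at *
        cases β <;> simp [hR, h] at * <;>
        · generalize c.ψ R (s x) = a at *
          try rw [h1]
          generalize c.ψ R (s (c.p S true)) = b at *
          generalize c.ψ S _ = d at *
          clear h; try clear h1
          revert a b d; decide
    · have h1 := c.hψ R S
      have h2 := c.hψ P S
      rw [if_neg (Ne.symm hS)] at h2
      by_cases hR : R = P
      · subst hR
        simp [hS, h2, Ne.symm hS]
      · simp only [hS, hR, false_and, if_false]
        rw [← h1]
        simp only [LinearMap.add_apply, LinearMap.smul_apply, smul_eq_mul]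
        linear_combination (c.g R (c.p P β) + c.g R x) * h2

section
variable (c : Cfg s j) (P : Fin j) (β : Bool) (x : ι) (hx : c.Free x)
    (h : c.g P x = c.g P (c.p P β) + 1)

lemma move_p_ne {R : Fin j} (hR : R ≠ P) (γ : Bool) : (c.move P β x hx h).p R γ = c.p R γ := by
  simp [move, hR]

lemma move_f (i : ι) : (c.move P β x hx h).f i = c.f i + (c.f (c.p P true) + c.f x) * c.g P i := by
  simp [move, f, g]

lemma move_g_self (i : ι) : (c.move P β x hx h).g P i = c.g P i := by
  simp [move, g]

lemma move_g_ne {R : Fin j} (hR : R ≠ P) (i : ι) : (c.move P β x hx h).g R i =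
    c.g R i + (c.g R (c.p P true) + c.g R x) * c.g P i := by
  rw [← c.g_ne hR β]
  simp [move, g, hR]

lemma move_p_x : (c.move P β x hx h).p P (!β) = x := by simp [move]

lemma move_f_P (γ : Bool) : (c.move P β x hx h).f ((c.move P β x hx h).p P γ)
    = (c.move P β x hx h).f x := by
  rw [f_p, ← f_p _ _ (!β), move_p_x]

lemma move_g_P {R : Fin j} (hR : R ≠ P) (γ : Bool) :
    (c.move P β x hx h).g R ((c.move P β x hx h).p P γ) = (c.move P β x hx h).g R x := by
  rw [g_ne _ hR, ← g_ne _ hR (!β), move_p_x]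

lemma move_free {y : ι} (hy : c.Free y) (hxy : y ≠ x) : (c.move P β x hx h).Free y := by
  intro R γ
  simp only [move]
  split_ifs
  · exact hxy.symm
  · exact hy _ _

lemma move_free' : (c.move P β x hx h).Free (c.p P (!β)) := by
  intro R γ
  simp only [move]
  split_ifs with h1
  · exact (hx _ _).symm
  · intro e
    exact h1 (c.inj _ _ _ _ e)

lemma move_sep (hs : c.Sep) : (c.move P β x hx h).Sep := by
  intro v h1 h2
  have hP : c.ψ P v = 0 := by simpa [move] using h2 P
  apply hs
  · simpa [move, hP] using h1
  · intro R
    by_cases hR : R = P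
    · rw [hR, hP]
    · simpa [move, hP, hR] using h2 R
end

/-- Every configuration is bad. -/
def Bad (s : ι → V) (j : ℕ) : Prop :=
  ∀ c : Cfg s j, c.Sep → ∑ R, c.f (c.p R true) = 1

section

lemma fact1 (hB : Bad s j) (c : Cfg s j) (hc : c.Sep)
    {P : Fin j} {x : ι} (hx : c.Free x) (hf : c.f x = c.f (c.p P true) + 1) :
    ∑ R ∈ Finset.univ.erase P, c.g P (c.p R true) = c.g P x + 1 := by
  obtain ⟨β, h⟩ := c.ex_beta P x
  have h1 := hB c hc
  have h2 := hB _ (c.move_sep P β x hx h hc)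
  rw [← Finset.add_sum_erase _ _ (Finset.mem_univ P)] at h1 h2
  rw [move_f_P, Finset.sum_congr rfl (g := fun R => c.f (c.p R true) + c.g P (c.p R true)),
    Finset.sum_add_distrib, move_f] at h2
  · generalize (∑ R ∈ Finset.univ.erase P, c.g P (c.p R true)) = a at *
    generalize (∑ R ∈ Finset.univ.erase P, c.f (c.p R true)) = b at *
    generalize c.f (c.p P true) = d at *
    rw [hf] at h2
    generalize c.g P x = e at *
    clear h hf hx
    revert a b d e; decide
  · intro R hR
    rw [move_p_ne _ _ _ _ _ _ (Finset.ne_of_mem_erase hR), move_f, hf]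
    generalize c.f (c.p P true) = d at *
    generalize c.f (c.p R true) = b at *
    generalize c.g P (c.p R true) = a at *
    clear h2 h1 hf
    revert a b d; decide

lemma fact1' (hB : Bad s j) (c : Cfg s j) (hc : c.Sep)
    {P : Fin j} {x y : ι} (hx : c.Free x) (hf : c.f x = c.f (c.p P true) + 1)
    (hy : c.Free y) (hf' : c.f y = c.f (c.p P true) + 1) : c.g P x = c.g P y := by
  have h1 := c.fact1 hB hc hx hf
  have h2 := c.fact1 hB hc hy hf'
  exact add_right_cancel (h1.symm.trans h2)

lemma fact2 (hB : Bad s j) (c : Cfg s j) (hc : c.Sep)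
    {P R : Fin j} {x y : ι} (hx : c.Free x) (hy : c.Free y) (hxy : y ≠ x)
    (hfx : c.f x = c.f (c.p P true)) (hfy : c.f y = c.f (c.p P true))
    (hR : c.f (c.p R true) = c.f (c.p P true) + 1)
    (hne : c.g R x = c.g R (c.p P true) + 1) : c.g P x = c.g P y + 1 := by
  obtain ⟨β, h⟩ := c.ex_beta P x
  have hRP : R ≠ P := by
    rintro rfl
    generalize c.f (c.p R true) = a at hR
    clear * - hR
    revert a; decide
  have e : c.f x = c.f (c.p R true) + 1 := by
    rw [hfx, hR]; generalize c.f _ = a; revert a; decide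
  have e' : c.f y = c.f (c.p R true) + 1 := by
    rw [hfy, hR]; generalize c.f _ = a; revert a; decide
  have h0 := c.fact1' hB hc hx e hy e'
  have hz : c.f (c.p P true) + c.f x = 0 := by
    rw [hfx]; generalize c.f _ = a; revert a; decide
  have h1 := (c.move P β x hx h).fact1' hB (c.move_sep P β x hx h hc) (P := R)
    (c.move_free P β x hx h hy hxy) (by rw [move_p_ne _ _ _ _ _ _ hRP, move_f, move_f, hz, e']; simp)
    (c.move_free' P β x hx h) (by
      rw [move_p_ne _ _ _ _ _ _ hRP, move_f, move_f, hz, c.f_p, ← hfx, e]; simp)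
  rw [move_g_ne _ _ _ _ _ _ hRP, move_g_ne _ _ _ _ _ _ hRP, c.g_ne hRP (!β), ← h0, hne, c.g_self] at h1
  rw [h]
  generalize c.g R (c.p P true) = a at *
  generalize c.g P y = b at *
  generalize c.g P (c.p P β) = d at *
  clear * - h1
  revert a b d; decide

lemma fact3 (hB : Bad s j) (c : Cfg s j) (hc : c.Sep)
    {P R : Fin j} {x y z : ι} (hx : c.Free x) (hy : c.Free y) (hz : c.Free z)
    (hxy : y ≠ x) (hxz : z ≠ x) (hyz : z ≠ y)
    (hfx : c.f x = c.f (c.p P true)) (hfy : c.f y = c.f (c.p P true))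
    (hfz : c.f z = c.f (c.p P true))
    (hR : c.f (c.p R true) = c.f (c.p P true) + 1) : c.g R x = c.g R (c.p P true) := by
  rcases z2 (c.g R x + c.g R (c.p P true)) with h | h
  · generalize c.g R x = a at *
    generalize c.g R (c.p P true) = b at *
    clear * - h
    revert a b; decide
  · exfalso
    have hx1 : c.g R x = c.g R (c.p P true) + 1 := by
      generalize c.g R x = a at *
      generalize c.g R (c.p P true) = b at *
      clear * - h
      revert a b; decide
    have e : ∀ i, c.f i = c.f (c.p P true) → c.f i = c.f (c.p R true) + 1 := by
      intro i hi
      rw [hi, hR]; generalize c.f _ = a; revert a; decide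
    have hy1 := hx1
    rw [c.fact1' hB hc hx (e _ hfx) hy (e _ hfy)] at hy1
    have a1 := c.fact2 hB hc hx hy hxy hfx hfy hR hx1
    have a2 := c.fact2 hB hc hx hz hxz hfx hfz hR hx1
    have a3 := c.fact2 hB hc hy hz hyz hfy hfz hR hy1
    generalize c.g P x = a at *
    generalize c.g P y = b at *
    generalize c.g P z = d at *
    clear * - a1 a2 a3
    revert a b d; decide

end
/-- Number of pairs of class `ε`. -/
def cnt (c : Cfg s j) (ε : ZMod 2) : ℕ := (Finset.univ.filter (fun R => c.f (c.p R true) = ε)).card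

lemma cnt_add (c : Cfg s j) : c.cnt 0 + c.cnt 1 = j := by
  have := Finset.card_filter_add_card_filter_not (s := Finset.univ) (fun R => c.f (c.p R true) = 0)
  rw [Finset.card_univ, Fintype.card_fin] at this
  conv_rhs => rw [← this]
  unfold cnt
  congr 2
  ext i
  simp only [Finset.mem_filter]
  rcases z2 (c.f (c.p i true)) with h | h <;> simp [h]

lemma odd_cnt (hB : Bad s j) (hj : Even j) (c : Cfg s j) (hc : c.Sep) (ε : ZMod 2) :
    Odd (c.cnt ε) := by
  have h1 : Odd (c.cnt 1) := by
    have h := hB c hc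
    have : ∑ R, c.f (c.p R true) = (c.cnt 1 : ZMod 2) := by
      rw [cnt, Finset.card_filter, Nat.cast_sum]
      refine Finset.sum_congr rfl fun i _ => ?_
      rcases z2 (c.f (c.p i true)) with h | h <;> simp [h]
    rw [this, ZMod.natCast_eq_one_iff_odd] at h
    exact h
  rcases z2 ε with rfl | rfl
  · have := c.cnt_add
    rw [← this, Nat.even_add] at hj
    rw [← Nat.not_even_iff_odd] at *
    tauto
  · exact h1


section
open Classical in
/-- The set of free points. -/
noncomputable def A [Fintype ι] (c : Cfg s j) : Finset ι := Finset.univ.filter c.Free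

variable [Fintype ι]

lemma mem_A (c : Cfg s j) (x : ι) : x ∈ c.A ↔ c.Free x := by simp [A]

lemma sum_all {M : Type} [AddCommMonoid M] (c : Cfg s j) (u : ι → M) :
    ∑ i, u i = (∑ R, (u (c.p R true) + u (c.p R false))) + ∑ i ∈ c.A, u i := by
  classical
  have hinj : Function.Injective (fun q : Fin j × Bool => c.p q.1 q.2) := by
    rintro ⟨R, γ⟩ ⟨R', γ'⟩ e
    obtain ⟨h1, h2⟩ := c.inj _ _ _ _ e
    exact Prod.ext h1 h2
  have hA : c.A = (Finset.univ.image (fun q : Fin j × Bool => c.p q.1 q.2))ᶜ := by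
    ext x
    simp [mem_A, Free]
  rw [hA, ← Finset.sum_add_sum_compl (Finset.univ.image (fun q : Fin j × Bool => c.p q.1 q.2)),
    Finset.sum_image (fun a _ b _ e => hinj e), Fintype.sum_prod_type]
  simp

lemma card_A (c : Cfg s j) : Fintype.card ι = 2 * j + c.A.card := by
  have := c.sum_all (fun _ => (1 : ℕ))
  simp at this
  omega

lemma sum_f_A (hs : ∑ i, s i = 0) (c : Cfg s j) : ∑ i ∈ c.A, c.f i = 0 := by
  have h := c.sum_all c.f
  have h0 : ∑ i, c.f i = 0 := by
    unfold f
    rw [← map_sum, hs, map_zero]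
  rw [h0] at h
  simp only [c.f_p _ false, CharTwo.add_self_eq_zero] at h
  simpa using h.symm

lemma sum_g_A (hs : ∑ i, s i = 0) (c : Cfg s j) (P : Fin j) : ∑ i ∈ c.A, c.g P i = 1 := by
  have h := c.sum_all (c.g P)
  have h0 : ∑ i, c.g P i = 0 := by
    unfold g
    rw [← map_sum, hs, map_zero]
  rw [h0] at h
  have h2 : ∀ R, c.g P (c.p R true) + c.g P (c.p R false) = if P = R then 1 else 0 :=
    fun R => c.hψ P R
  simp only [h2, Finset.sum_ite_eq, Finset.mem_univ, if_true] at h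
  generalize (∑ i ∈ c.A, c.g P i) = a at *
  clear * - h
  revert a; decide

/-- Free points of class `ε`. -/
noncomputable def AA (c : Cfg s j) (ε : ZMod 2) : Finset ι := c.A.filter (fun i => c.f i = ε)

lemma mem_AA (c : Cfg s j) (ε : ZMod 2) (x : ι) : x ∈ c.AA ε ↔ c.Free x ∧ c.f x = ε := by
  simp [AA, mem_A]

lemma AA_add (c : Cfg s j) : (c.AA 0).card + (c.AA 1).card = c.A.card := by
  classical
  rw [← Finset.card_filter_add_card_filter_not (s := c.A) (fun i => c.f i = 0), AA, AA]
  congr 2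
  ext i
  simp only [Finset.mem_filter]
  rcases z2 (c.f i) with h | h <;> simp [h]

lemma even_AA (hs : ∑ i, s i = 0) (hn : Even (Fintype.card ι)) (c : Cfg s j) (ε : ZMod 2) :
    Even (c.AA ε).card := by
  have h1 : Even (c.AA 1).card := by
    have h := c.sum_f_A hs
    have : ∑ i ∈ c.A, c.f i = ((c.AA 1).card : ZMod 2) := by
      rw [AA, Finset.card_filter, Nat.cast_sum]
      refine Finset.sum_congr rfl fun i _ => ?_
      rcases z2 (c.f i) with h | h <;> simp [h]
    rw [this, ZMod.natCast_eq_zero_iff_even] at h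
    exact h
  rcases z2 ε with rfl | rfl
  · have := c.card_A
    have h3 := c.AA_add
    rw [this, Nat.even_add] at hn
    have h4 : Even c.A.card := hn.1 (even_two_mul j)
    rw [← h3, Nat.even_add] at h4
    exact h4.2 h1
  · exact h1

lemma fact4 (hB : Bad s j) (hj : Even j) (hs : ∑ i, s i = 0) (hn : Even (Fintype.card ι))
    (N : ℕ) : ∀ (c : Cfg s j), c.Sep → ∀ ε, 3 ≤ (c.AA ε).card → ¬ j < c.cnt ε + N := by
  classical
  induction N with
  | zero =>
    intro c _ ε _
    have := c.cnt_add
    rcases z2 ε with rfl | rfl <;> omega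
  | succ N ih =>
  intro c hc ε h3 hlt
  have h4 : 4 ≤ (c.AA ε).card := by
    obtain ⟨r, hr⟩ := c.even_AA hs hn ε
    omega
  obtain ⟨Q, hQ⟩ : ∃ Q, c.f (c.p Q true) = ε + 1 := by
    have := c.odd_cnt hB hj hc (ε + 1)
    have h5 : 0 < c.cnt (ε + 1) := this.pos
    obtain ⟨Q, hQ⟩ := Finset.card_pos.1 h5
    exact ⟨Q, by simpa using hQ⟩
  obtain ⟨x, hx, y, hy, z, hz, hxy, hxz, hyz⟩ := Finset.two_lt_card.1 h3
  rw [mem_AA] at hx hy hz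
  obtain ⟨β, h⟩ := c.ex_beta Q x
  have hε : ε + 1 + 1 = ε := by clear * -; revert ε; decide
  have hxQ : c.f (c.p Q true) + c.f x = 1 := by
    rw [hQ, hx.2]; clear * -; revert ε; decide
  have key : ∀ P, c.f (c.p P true) = ε → c.g Q (c.p P true) = c.g Q x := by
    intro P hP
    exact (c.fact3 hB hc hx.1 hy.1 hz.1 hxy.symm hxz.symm hyz.symm (by rw [hx.2, hP])
      (by rw [hy.2, hP]) (by rw [hz.2, hP]) (by rw [hQ, hP])).symm
  set c' := c.move Q β x hx.1 h with hc'
  have hs' : c'.Sep := c.move_sep Q β x hx.1 h hc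
  have hA' : (c.AA ε).erase x ⊆ c'.AA (c'.f x) := by
    intro y hy
    rw [Finset.mem_erase, mem_AA] at hy
    rw [mem_AA]
    refine ⟨c.move_free Q β x hx.1 h hy.2.1 hy.1, ?_⟩
    rw [hc', move_f, move_f, hy.2.2, hx.2, c.fact1' hB hc hy.2.1 (by rw [hy.2.2, hQ, hε]) hx.1
      (by rw [hx.2, hQ, hε])]
  have h3' : 3 ≤ (c'.AA (c'.f x)).card := by
    have := Finset.card_le_card hA'
    rw [Finset.card_erase_of_mem (by rw [mem_AA]; exact hx)] at this
    omega
  have hcnt : c.cnt ε + 1 ≤ c'.cnt (c'.f x) := by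
    unfold cnt
    have hn : Q ∉ (Finset.univ.filter (fun R => c.f (c.p R true) = ε)) := by
      simp [hQ]
    rw [← Finset.card_insert_of_notMem hn]
    apply Finset.card_le_card
    intro R hR
    rw [Finset.mem_insert] at hR
    simp only [Finset.mem_filter, Finset.mem_univ, true_and] at hR ⊢
    by_cases hRQ : R = Q
    · subst hRQ
      exact c.move_f_P R β x hx.1 h true
    · have hR1 := hR.resolve_left hRQ
      rw [hc', move_p_ne _ _ _ _ _ _ hRQ, move_f, move_f, hR1, hx.2, key R hR1]
  exact ih c' hs' (c'.f x) h3' (by omega)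
end

lemma erase_sum {P Q : Fin j} (h : P ≠ Q) (u : Fin j → ZMod 2) :
    ∑ R ∈ Finset.univ.erase Q, u R = u P + ∑ R ∈ (Finset.univ.erase P).erase Q, u R := by
  rw [Finset.erase_right_comm, Finset.add_sum_erase]
  simp [h]


section

lemma fact6 (hB : Bad s j) (c : Cfg s j) (hc : c.Sep)
    {P Q : Fin j} {x z : ι} (hx : c.Free x) (hz : c.Free z)
    (hQ : c.f (c.p Q true) = c.f (c.p P true) + 1)
    (hfx : c.f x = c.f (c.p P true)) (hfz : c.f z = c.f (c.p P true) + 1)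
    (h0 : c.g P (c.p Q true) = c.g P z) : c.g Q (c.p P true) = c.g Q x := by
  obtain ⟨β, h⟩ := c.ex_beta P z
  have hQP : Q ≠ P := by
    rintro rfl
    generalize c.f (c.p Q true) = a at hQ
    clear * - hQ
    revert a; decide
  have e1 : c.f (c.p P true) + c.f z = 1 := by
    rw [hfz]; generalize c.f _ = a; revert a; decide
  have h1 := (c.move P β z hz h).fact1 hB (c.move_sep P β z hz h hc) (P := Q)
    (c.move_free' P β z hz h) (by
      rw [move_p_ne _ _ _ _ _ _ hQP, move_f, move_f, e1, c.f_p, hQ, h0, h, c.g_self]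
      generalize c.f (c.p P true) = a
      generalize c.g P (c.p P β) = b
      clear * -
      revert a b; decide)
  have h2 := c.fact1 hB hc (P := P) hz hfz
  have h3 := c.fact1 hB hc (P := Q) hx (by
    rw [hQ, hfx]; generalize c.f _ = a; revert a; decide)
  rw [erase_sum hQP.symm, move_g_P _ _ _ _ _ _ hQP] at h1
  rw [erase_sum hQP, h0, Finset.erase_right_comm] at h2
  rw [erase_sum hQP.symm] at h3
  rw [Finset.sum_congr rfl (g := fun R => c.g Q (c.p R true) +
    (c.g Q (c.p P true) + c.g Q z) * c.g P (c.p R true))] at h1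
  · rw [Finset.sum_add_distrib, ← Finset.mul_sum, move_g_ne _ _ _ _ _ _ hQP,
      move_g_ne _ _ _ _ _ _ hQP, c.g_ne hQP (!β), c.g_self, h] at h1
    rw [h] at h2
    generalize (∑ R ∈ (Finset.univ.erase P).erase Q, c.g Q (c.p R true)) = s1 at *
    generalize (∑ R ∈ (Finset.univ.erase P).erase Q, c.g P (c.p R true)) = s2 at *
    generalize c.g Q (c.p P true) = a1 at *
    generalize c.g P (c.p P β) = a2 at *
    generalize c.g Q x = a3 at *
    generalize c.g Q z = a4 at *
    clear * - h1 h2 h3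
    revert s1 s2 a1 a2 a3 a4
    decide
  · intro R hR
    simp only [Finset.mem_erase] at hR
    rw [move_p_ne _ _ _ _ _ _ hR.2.1, move_g_ne _ _ _ _ _ _ hQP]

lemma fact7 (hB : Bad s j) (c : Cfg s j) (hc : c.Sep)
    {P R : Fin j} {x z : ι} (hRP : R ≠ P) (hx : c.Free x) (hz : c.Free z)
    (hR : c.f (c.p R true) = c.f (c.p P true))
    (hfx : c.f x = c.f (c.p P true)) (hfz : c.f z = c.f (c.p P true) + 1)
    (h0 : c.g R (c.p P true) = c.g R x + 1) : c.g P (c.p R true) = c.g P x := by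
  obtain ⟨β, h⟩ := c.ex_beta P x
  have e1 : c.f (c.p P true) + c.f x = 0 := by
    rw [hfx]; generalize c.f _ = a; revert a; decide
  have hzx : z ≠ x := by
    rintro rfl
    rw [hfx] at hfz
    generalize c.f _ = a at hfz
    clear * - hfz
    revert a; decide
  have h1 := (c.move P β x hx h).fact1 hB (c.move_sep P β x hx h hc) (P := R)
    (c.move_free P β x hx h hz hzx) (by
      rw [move_p_ne _ _ _ _ _ _ hRP, move_f, move_f, e1, hR, hfz]
      simp)
  have h2 := c.fact1 hB hc (P := P) hz hfz
  have h3 := c.fact1 hB hc (P := R) hz (by rw [hR, hfz])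
  rw [erase_sum hRP.symm, move_g_P _ _ _ _ _ _ hRP] at h1
  rw [erase_sum hRP, Finset.erase_right_comm] at h2
  rw [erase_sum hRP.symm] at h3
  rw [Finset.sum_congr rfl (g := fun S => c.g R (c.p S true) +
    (c.g R (c.p P true) + c.g R x) * c.g P (c.p S true))] at h1
  · rw [Finset.sum_add_distrib, ← Finset.mul_sum, move_g_ne _ _ _ _ _ _ hRP,
      move_g_ne _ _ _ _ _ _ hRP, h0] at h1
    rw [h0] at h3
    generalize (∑ S ∈ (Finset.univ.erase P).erase R, c.g R (c.p S true)) = s1 at *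
    generalize (∑ S ∈ (Finset.univ.erase P).erase R, c.g P (c.p S true)) = s2 at *
    generalize c.g P (c.p R true) = a1 at *
    generalize c.g P x = a2 at *
    generalize c.g P z = a5 at *
    generalize c.g R x = a3 at *
    generalize c.g R z = a4 at *
    clear * - h1 h2 h3
    revert s1 s2 a1 a2 a3 a4 a5
    decide
  · intro S hS
    simp only [Finset.mem_erase] at hS
    rw [move_p_ne _ _ _ _ _ _ hS.2.1, move_g_ne _ _ _ _ _ _ hRP]

end

section
variable [Fintype ι]

lemma fact8 (hB : Bad s j) (hj : 4 ∣ j) (hs : ∑ i, s i = 0)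
    (hn : Fintype.card ι = 2 * j + 4) (c : Cfg s j) (hc : c.Sep) : False := by
  classical
  have hje : Even j := by obtain ⟨q, hq⟩ := hj; exact ⟨2 * q, by omega⟩
  have hne : Even (Fintype.card ι) := ⟨j + 2, by omega⟩
  have hle : ∀ ε, ¬ 3 ≤ (c.AA ε).card := by
    intro ε h3
    exact fact4 hB hje hs hne (j + 1) c hc ε h3 (by omega)
  have h2 : ∀ ε, (c.AA ε).card = 2 := by
    have h1 := c.card_A
    have h2 := c.AA_add
    have h3 := hle 0
    have h4 := hle 1
    intro ε
    rcases z2 ε with rfl | rfl <;> omega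
  have h2' : ∀ ε, ∃ x y, x ≠ y ∧ c.AA ε = {x, y} := fun ε => Finset.card_eq_two.1 (h2 ε)
  choose e e' hee hAA using h2'
  have he : ∀ ε, c.Free (e ε) ∧ c.f (e ε) = ε := by
    intro ε; rw [← mem_AA, hAA]; simp
  have he' : ∀ ε, c.Free (e' ε) ∧ c.f (e' ε) = ε := by
    intro ε; rw [← mem_AA, hAA]; simp
  have f5 : ∀ P, c.g P (e' (c.f (c.p P true))) = c.g P (e (c.f (c.p P true))) + 1 := by
    intro P
    have h1 := c.sum_g_A hs P
    have hsplit : ∀ u : ι → ZMod 2, ∑ i ∈ c.A, u i = ∑ i ∈ c.AA 0, u i + ∑ i ∈ c.AA 1, u i := by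
      intro u
      rw [← Finset.sum_filter_add_sum_filter_not c.A (fun i => c.f i = 0), AA, AA]
      congr 1
      refine Finset.sum_congr ?_ (fun _ _ => rfl)
      ext i
      simp only [Finset.mem_filter]
      rcases z2 (c.f i) with h | h <;> simp [h]
    rw [hsplit, hAA, hAA, Finset.sum_pair (hee 0), Finset.sum_pair (hee 1)] at h1
    rcases z2 (c.f (c.p P true)) with h | h
    · have := c.fact1' hB hc (P := P) (he 1).1 (by rw [(he 1).2, h]; rfl) (he' 1).1
        (by rw [(he' 1).2, h]; rfl)
      rw [h]
      rw [this] at h1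
      generalize c.g P (e 0) = a at *
      generalize c.g P (e' 0) = b at *
      generalize c.g P (e' 1) = d at *
      clear * - h1
      revert a b d; decide
    · have := c.fact1' hB hc (P := P) (he 0).1 (by rw [(he 0).2, h]; rfl) (he' 0).1
        (by rw [(he' 0).2, h]; rfl)
      rw [h]
      rw [this] at h1
      generalize c.g P (e 1) = a at *
      generalize c.g P (e' 1) = b at *
      generalize c.g P (e' 0) = d at *
      clear * - h1
      revert a b d; decide
  set M : Fin j → Fin j → ZMod 2 := fun P R =>
    c.g P (c.p R true) + c.g P (e (c.f (c.p R true))) with hM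
  have o0 := c.odd_cnt hB hje hc 0
  have o1 := c.odd_cnt hB hje hc 1
  have row : ∀ P, ∑ R ∈ Finset.univ.erase P, M P R = 1 := by
    intro P
    have h1 := c.fact1 hB hc (P := P) (he (c.f (c.p P true) + 1)).1 (he _).2
    have h3 : ∑ R, c.g P (e (c.f (c.p R true))) = c.g P (e 0) + c.g P (e 1) := by
      have : ∀ R, c.g P (e (c.f (c.p R true))) =
          (if c.f (c.p R true) = 0 then 1 else 0) * c.g P (e 0) +
          (if c.f (c.p R true) = 1 then 1 else 0) * c.g P (e 1) := by
        intro R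
        rcases z2 (c.f (c.p R true)) with h | h <;> simp [h]
      simp_rw [this]
      rw [Finset.sum_add_distrib, ← Finset.sum_mul, ← Finset.sum_mul]
      have q0 : ((c.cnt 0 : ℕ) : ZMod 2) = 1 := ZMod.natCast_eq_one_iff_odd.2 o0
      have q1 : ((c.cnt 1 : ℕ) : ZMod 2) = 1 := ZMod.natCast_eq_one_iff_odd.2 o1
      rw [cnt, Finset.card_filter, Nat.cast_sum] at q0 q1
      simp only [Nat.cast_ite, Nat.cast_one, Nat.cast_zero] at q0 q1
      rw [q0, q1, one_mul, one_mul]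
    rw [← Finset.add_sum_erase _ _ (Finset.mem_univ P)] at h3
    rw [hM, Finset.sum_add_distrib, h1]
    generalize (∑ R ∈ Finset.univ.erase P, c.g P (e (c.f (c.p R true)))) = t at *
    have h01 : (0 : ZMod 2) + 1 = 1 := rfl
    have h11 : (1 : ZMod 2) + 1 = 0 := rfl
    rcases z2 (c.f (c.p P true)) with h | h <;> rw [h] at h3 ⊢ <;> simp only [h01, h11]
    all_goals
      generalize c.g P (e 0) = a at *
      generalize c.g P (e 1) = b at *
      clear * - h3
      revert a b t; decide
  have cross0 : ∀ P Q, c.f (c.p Q true) = c.f (c.p P true) + 1 → M P Q = 0 → M Q P = 0 := by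
    intro P Q h h0
    rw [hM] at h0 ⊢
    simp only at h0 ⊢
    have := c.fact6 hB hc (P := P) (Q := Q) (he (c.f (c.p P true))).1 (he (c.f (c.p Q true))).1 h
      (he _).2 (by rw [(he _).2, h]) (CharTwo.add_eq_zero.1 h0)
    rw [this, CharTwo.add_self_eq_zero]
  have cross : ∀ P Q, c.f (c.p Q true) ≠ c.f (c.p P true) → M P Q + M Q P = 0 := by
    intro P Q h
    have a1 : c.f (c.p Q true) = c.f (c.p P true) + 1 := by
      generalize c.f (c.p Q true) = a at *
      generalize c.f (c.p P true) = b at *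
      clear * - h
      revert a b; decide
    have a2 : c.f (c.p P true) = c.f (c.p Q true) + 1 := by
      rw [a1]; generalize c.f _ = a; revert a; decide
    have b1 := cross0 P Q a1
    have b2 := cross0 Q P a2
    generalize M P Q = a at *
    generalize M Q P = b at *
    clear * - b1 b2
    revert a b; decide
  have same : ∀ P R, R ≠ P → c.f (c.p R true) = c.f (c.p P true) → M P R + M R P = 1 := by
    intro P R hRP h
    have k1 := fun h0 => c.fact7 hB hc (P := P) (R := R) hRP (he (c.f (c.p P true))).1
      (he (c.f (c.p P true) + 1)).1 h (he _).2 (he _).2 h0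
    have k2 := fun h0 => c.fact7 hB hc (P := P) (R := R) hRP (he' (c.f (c.p P true))).1
      (he (c.f (c.p P true) + 1)).1 h (he' _).2 (he _).2 h0
    have k3 := fun h0 => c.fact7 hB hc (P := R) (R := P) hRP.symm (he (c.f (c.p R true))).1
      (he (c.f (c.p R true) + 1)).1 h.symm (he _).2 (he _).2 h0
    have f1 := f5 P
    have f2 := f5 R
    rw [hM]
    simp only
    rw [h] at *
    rw [f1, f2] at k2
    generalize c.g R (c.p P true) = a at *
    generalize c.g P (c.p R true) = b at *
    generalize c.g P (e (c.f (c.p P true))) = u at *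
    generalize c.g R (e (c.f (c.p P true))) = v at *
    clear * - k1 k2 k3
    revert a b u v; decide
  -- double counting
  set K : ℕ := ∑ P : Fin j, ∑ R : Fin j,
    if P < R ∧ c.f (c.p R true) = c.f (c.p P true) then 1 else 0 with hK
  have tot : ∑ P, ∑ R ∈ Finset.univ.erase P, M P R = 0 := by
    simp_rw [row]
    simp only [Finset.sum_const, Finset.card_univ, Fintype.card_fin, nsmul_eq_mul, mul_one]
    exact ZMod.natCast_eq_zero_iff_even.2 hje
  have hKeven : (K : ZMod 2) = 0 := by
    rw [← tot]
    have e1 : ∀ P, ∑ R ∈ Finset.univ.erase P, M P R =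
        ∑ R, (if P < R then M P R else 0) + ∑ R, (if R < P then M P R else 0) := by
      intro P
      rw [← Finset.sum_add_distrib, ← Finset.add_sum_erase _ _ (Finset.mem_univ P)]
      simp only [lt_irrefl, if_false, add_zero, zero_add]
      refine Finset.sum_congr rfl fun R hR => ?_
      rcases lt_or_gt_of_ne (Finset.ne_of_mem_erase hR) with h | h
      · simp [h, h.not_gt]
      · simp [h, h.not_gt]
    simp_rw [e1]
    rw [Finset.sum_add_distrib, Finset.sum_comm (f := fun P R => if R < P then M P R else 0),
      ← Finset.sum_add_distrib, hK, Nat.cast_sum]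
    refine Finset.sum_congr rfl fun P _ => ?_
    rw [← Finset.sum_add_distrib, Nat.cast_sum]
    refine Finset.sum_congr rfl fun R _ => ?_
    by_cases hlt : P < R
    · by_cases hcl : c.f (c.p R true) = c.f (c.p P true)
      · simp [hlt, hcl, same P R hlt.ne' hcl]
      · simp [hlt, hcl, cross P R hcl]
    · simp [hlt]
  have hcount : c.cnt 0 * c.cnt 0 + c.cnt 1 * c.cnt 1 = 2 * K + j := by
    have e1 : ∑ P : Fin j, ∑ R : Fin j, (if c.f (c.p R true) = c.f (c.p P true) then 1 else 0)
        = c.cnt 0 * c.cnt 0 + c.cnt 1 * c.cnt 1 := by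
      have : ∀ P : Fin j, ∑ R : Fin j, (if c.f (c.p R true) = c.f (c.p P true) then 1 else 0) =
          (if c.f (c.p P true) = 0 then 1 else 0) * c.cnt 0 +
          (if c.f (c.p P true) = 1 then 1 else 0) * c.cnt 1 := by
        intro P
        rw [← Finset.card_filter]
        rcases z2 (c.f (c.p P true)) with h | h <;> simp [h, cnt]
      simp_rw [this]
      rw [Finset.sum_add_distrib, ← Finset.sum_mul, ← Finset.sum_mul, ← Finset.card_filter,
        ← Finset.card_filter]
      rfl
    rw [← e1]
    have e2 : ∀ P R : Fin j, (if c.f (c.p R true) = c.f (c.p P true) then 1 else 0) =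
        (if P < R ∧ c.f (c.p R true) = c.f (c.p P true) then 1 else 0) +
        (if R < P ∧ c.f (c.p P true) = c.f (c.p R true) then 1 else 0) +
        (if P = R then 1 else 0) := by
      intro P R
      rcases lt_trichotomy P R with h | h | h
      · simp [h, h.not_gt, h.ne]
      · simp [h]
      · simp [h, h.not_gt, h.ne', eq_comm]
    simp_rw [e2, Finset.sum_add_distrib]
    rw [Finset.sum_comm (f := fun P R =>
      if R < P ∧ c.f (c.p P true) = c.f (c.p R true) then 1 else 0)]
    rw [← hK]
    simp only [Finset.sum_ite_eq, Finset.mem_univ, if_true, Finset.sum_const, Finset.card_univ,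
      Fintype.card_fin, smul_eq_mul, mul_one]
    omega
  obtain ⟨a, ha⟩ := o0
  obtain ⟨b, hb⟩ := o1
  obtain ⟨q, hq⟩ := hj
  obtain ⟨t, ht⟩ := ZMod.natCast_eq_zero_iff_even.1 hKeven
  rw [ha, hb, hq, ht] at hcount
  ring_nf at hcount
  omega
end

section

lemma sol (c : Cfg s j) (L : Finset ι) (hL : ∀ i ∈ L, c.Free i) :
    ∃ T : Finset ι, T.card = j + L.card ∧ (∀ R, c.ψ R (∑ i ∈ T, s i) = 0) ∧
      ∀ (W : Type) [AddCommGroup W] [Module (ZMod 2) W] (θ : V →ₗ[ZMod 2] W),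
        (∀ R, θ (s (c.p R true)) = θ (s (c.p R false))) →
        θ (∑ i ∈ T, s i) = ∑ R, θ (s (c.p R true)) + ∑ i ∈ L, θ (s i) := by
  classical
  set t : Fin j → ZMod 2 := fun Q => ∑ S, c.g Q (c.p S true) + ∑ i ∈ L, c.g Q i with ht
  set γ : Fin j → Bool := fun Q => decide (t Q = 0) with hγ
  have hinj : ∀ R S, c.p R (γ R) = c.p S (γ S) → R = S := fun R S e => (c.inj _ _ _ _ e).1
  have hdisj : Disjoint (Finset.univ.image (fun R => c.p R (γ R))) L := by
    rw [Finset.disjoint_left]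
    intro x hx hxL
    obtain ⟨R, _, rfl⟩ := Finset.mem_image.1 hx
    exact hL _ hxL R _ rfl
  have hsum : ∑ i ∈ Finset.univ.image (fun R => c.p R (γ R)) ∪ L, s i =
      ∑ R, s (c.p R (γ R)) + ∑ i ∈ L, s i := by
    rw [Finset.sum_union hdisj, Finset.sum_image (fun a _ b _ e => hinj a b e)]
  refine ⟨Finset.univ.image (fun R => c.p R (γ R)) ∪ L, ?_, ?_, ?_⟩
  · rw [Finset.card_union_of_disjoint hdisj, Finset.card_image_of_injective _ (fun a b e => hinj a b e)]
    simp
  · intro Q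
    rw [hsum, map_add, map_sum, map_sum]
    change ∑ R, c.g Q (c.p R (γ R)) + ∑ i ∈ L, c.g Q i = 0
    have h1 : ∀ R, c.g Q (c.p R (γ R)) = c.g Q (c.p R true) + if Q = R then t Q else 0 := by
      intro R
      by_cases h : Q = R
      · subst h
        rcases z2 (t Q) with h0 | h0
        · simp [hγ, h0]
        · have := c.g_self Q true
          simp only [Bool.not_true] at this
          simp [hγ, h0, this]
      · rw [c.g_ne h]; simp [h]
    simp_rw [h1]
    rw [Finset.sum_add_distrib]
    simp only [Finset.sum_ite_eq, Finset.mem_univ, if_true]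
    have : t Q = ∑ S, c.g Q (c.p S true) + ∑ i ∈ L, c.g Q i := rfl
    rw [this]
    generalize (∑ S, c.g Q (c.p S true)) = a
    generalize (∑ i ∈ L, c.g Q i) = b
    clear * -
    revert a b; decide
  · intro W _ _ θ hθ
    rw [hsum, map_add, map_sum, map_sum]
    congr 1
    refine Finset.sum_congr rfl fun R _ => ?_
    cases γ R
    · exact (hθ R).symm
    · rfl

lemma bad_of_not (hno : ¬ ∃ T : Finset ι, T.card = j ∧ ∑ i ∈ T, s i = 0) : Bad s j := by
  intro c hc
  rcases z2 (∑ R, c.f (c.p R true)) with h | h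
  · exfalso
    obtain ⟨T, h1, h2, h3⟩ := c.sol ∅ (by simp)
    refine hno ⟨T, by simpa using h1, hc _ ?_ h2⟩
    rw [h3 _ c.φ c.hφ, Finset.sum_empty, add_zero]
    exact h
  · exact h

/-- Change the functional `φ`. -/
def withφ (c : Cfg s j) (θ : V →ₗ[ZMod 2] ZMod 2)
    (h : ∀ R, θ (s (c.p R true)) = θ (s (c.p R false))) : Cfg s j :=
  { c with φ := θ, hφ := h }

/-- Add one more pair. -/
def extend (c : Cfg s j) (x y : ι) (hx : c.Free x) (hy : c.Free y)
    (h : c.f x = c.f y + 1) : Cfg s (j + 1) where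
  p := Fin.cons (fun b => if b then x else y) c.p
  inj := by
    have hxy : x ≠ y := by
      rintro rfl
      generalize c.f x = a at *
      clear * - h
      revert a; decide
    intro R γ R' γ'
    refine Fin.cases ?_ (fun R => ?_) R <;> refine Fin.cases ?_ (fun R' => ?_) R' <;>
      simp only [Fin.cons_zero, Fin.cons_succ] <;> intro e
    · cases γ <;> cases γ' <;> simp_all
    · cases γ <;> simp at e
      · exact absurd e.symm (hy _ _)
      · exact absurd e.symm (hx _ _)
    · cases γ' <;> simp at e
      · exact absurd e (hy _ _)
      · exact absurd e (hx _ _)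
    · obtain ⟨h1, h2⟩ := c.inj _ _ _ _ e
      exact ⟨by rw [h1], h2⟩
  φ := 0
  ψ := Fin.cons c.φ (fun R => c.ψ R + (c.g R x + c.g R y) • c.φ)
  hφ := by intro R; simp
  hψ := by
    have h' : c.φ (s x) = c.φ (s y) + 1 := h
    intro R S
    refine Fin.cases ?_ (fun R => ?_) R <;> refine Fin.cases ?_ (fun S => ?_) S <;>
      simp only [Fin.cons_zero, Fin.cons_succ]
    · simp only [if_true, Bool.false_eq_true, if_false]
      rw [h']
      generalize c.φ (s y) = a
      clear * -
      revert a; decide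
    · rw [c.hφ S, CharTwo.add_self_eq_zero, if_neg (Fin.succ_ne_zero S).symm]
    · rw [if_neg (Fin.succ_ne_zero R)]
      simp only [if_true, Bool.false_eq_true, if_false, LinearMap.add_apply, LinearMap.smul_apply,
        smul_eq_mul, h']
      unfold g
      generalize c.φ (s y) = a
      generalize c.ψ R (s x) = b
      generalize c.ψ R (s y) = d
      clear * -
      revert a b d; decide
    · have h1 := c.hψ R S
      have h2 := c.hφ S
      simp only [LinearMap.add_apply, LinearMap.smul_apply, smul_eq_mul, h2, Fin.succ_inj]
      rw [← h1]
      generalize c.φ _ = a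
      generalize c.g R x + c.g R y = b
      generalize c.ψ R _ = d
      generalize c.ψ R _ = e
      clear * -
      revert a b d e; decide

/-- Projection killing all pair differences. -/
noncomputable def rho (c : Cfg s j) : V →ₗ[ZMod 2] V :=
  LinearMap.id + ∑ R, (c.ψ R).smulRight (s (c.p R true) + s (c.p R false))

lemma rho_apply (c : Cfg s j) (v : V) :
    c.rho v = v + ∑ R, c.ψ R v • (s (c.p R true) + s (c.p R false)) := by
  simp [rho]

lemma dbl (v : V) : v + v = 0 := by
  rw [← two_smul (ZMod 2) v]
  have : (2 : ZMod 2) = 0 := rfl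
  rw [this, zero_smul]

lemma rho_pair (c : Cfg s j) (S : Fin j) : c.rho (s (c.p S true)) = c.rho (s (c.p S false)) := by
  have h : c.rho (s (c.p S true) + s (c.p S false)) = 0 := by
    rw [rho_apply]
    have h1 : ∀ R, c.ψ R (s (c.p S true) + s (c.p S false)) = if R = S then 1 else 0 := by
      intro R
      rw [map_add, c.hψ]
    simp only [h1, ite_smul, one_smul, zero_smul, Finset.sum_ite_eq', Finset.mem_univ, if_true, dbl]
  rw [map_add] at h
  have h2 := dbl (c.rho (s (c.p S false)))
  exact add_right_cancel (h.trans h2.symm)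

lemma eq_zero_of_rho (c : Cfg s j) (v : V) (h : c.rho v = 0) (h2 : ∀ R, c.ψ R v = 0) : v = 0 := by
  rw [rho_apply] at h
  simpa [h2] using h

lemma exists_functional (v : V) (hv : v ≠ 0) : ∃ θ : V →ₗ[ZMod 2] ZMod 2, θ v = 1 := by
  by_contra hcon
  apply hv
  rw [← Module.forall_dual_apply_eq_zero_iff (ZMod 2)]
  intro θ
  exact (z2 (θ v)).resolve_right (fun h => hcon ⟨θ, h⟩)

lemma step [Fintype ι] {m : ℕ} (hm : Even m) (hn : 2 * m + 4 ≤ Fintype.card ι) (hjm : j < m)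
    (hno : ¬ ∃ T : Finset ι, T.card = m ∧ ∑ i ∈ T, s i = 0) (c : Cfg s j) :
    Nonempty (Cfg s (j + 1)) := by
  classical
  by_contra hnone
  have hne : ∀ (c : Cfg s j) x y, c.Free x → c.Free y → ¬ (c.f x = c.f y + 1) :=
    fun c x y hx hy h => hnone ⟨c.extend x y hx hy h⟩
  have hA := c.card_A
  have hA3 : 2 < c.A.card := by omega
  obtain ⟨x0, hx0, x1, hx1, x2, hx2, h01, h02, h12⟩ := Finset.two_lt_card.1 hA3
  rw [mem_A] at hx0 hx1 hx2
  have hpair : ∀ θ : V →ₗ[ZMod 2] ZMod 2, ∀ R,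
      (θ ∘ₗ c.rho) (s (c.p R true)) = (θ ∘ₗ c.rho) (s (c.p R false)) := by
    intro θ R
    simp [c.rho_pair R]
  have hfree : ∀ x, c.Free x → c.rho (s x) = c.rho (s x0) := by
    intro x hx
    by_contra h
    obtain ⟨θ, hθ⟩ := exists_functional (c.rho (s x) - c.rho (s x0)) (sub_ne_zero.2 h)
    refine hne (c.withφ (θ ∘ₗ c.rho) (hpair θ)) x x0 hx hx0 ?_
    change θ (c.rho (s x)) = θ (c.rho (s x0)) + 1
    rw [map_sub] at hθ
    rw [← hθ]; ring
  by_cases hall : ∀ P, c.rho (s (c.p P true)) = c.rho (s x0)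
  · obtain ⟨L, hLA, hLc⟩ := Finset.exists_subset_card_eq (s := c.A) (n := m - j) (by omega)
    have hLf : ∀ i ∈ L, c.Free i := fun i hi => (c.mem_A i).1 (hLA hi)
    obtain ⟨T, h1, h2, h3⟩ := c.sol L hLf
    refine hno ⟨T, by omega, c.eq_zero_of_rho _ ?_ h2⟩
    rw [h3 _ c.rho c.rho_pair, Finset.sum_congr rfl (fun R _ => hall R),
      Finset.sum_congr rfl (fun i hi => hfree i (hLf i hi))]
    simp only [Finset.sum_const, Finset.card_univ, Fintype.card_fin]
    rw [← add_smul, hLc]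
    obtain ⟨q, hq⟩ := hm
    have : j + (m - j) = q + q := by omega
    rw [this, add_smul, dbl]
  · push Not at hall
    obtain ⟨P, hP⟩ := hall
    obtain ⟨θ, hθ⟩ := exists_functional (c.rho (s x0) - c.rho (s (c.p P true)))
      (sub_ne_zero.2 hP.symm)
    set c1 := c.withφ (θ ∘ₗ c.rho) (hpair θ) with hc1
    have hf1 : ∀ x, c.Free x → c1.f x = c1.f (c1.p P true) + 1 := by
      intro x hx
      change θ (c.rho (s x)) = θ (c.rho (s (c.p P true))) + 1
      rw [hfree x hx, ← hθ, map_sub]; ring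
    have hpig : ∃ x y, c.Free x ∧ c.Free y ∧ y ≠ x ∧ c1.g P x = c1.g P y := by
      have : c1.g P x0 = c1.g P x1 ∨ c1.g P x0 = c1.g P x2 ∨ c1.g P x1 = c1.g P x2 := by
        generalize c1.g P x0 = a
        generalize c1.g P x1 = b
        generalize c1.g P x2 = d
        clear * -
        revert a b d; decide
      rcases this with h | h | h
      · exact ⟨x0, x1, hx0, hx1, h01.symm, h⟩
      · exact ⟨x0, x2, hx0, hx2, h02.symm, h⟩
      · exact ⟨x1, x2, hx1, hx2, h12.symm, h⟩
    obtain ⟨x, y, hx, hy, hyx, hg⟩ := hpig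
    obtain ⟨β, h⟩ := c1.ex_beta P x
    have hx' : c1.Free x := hx
    have hy' : c1.Free y := hy
    refine hne (c1.move P β x hx' h) (c1.p P (!β)) y (c1.move_free' P β x hx' h)
      (c1.move_free P β x hx' h hy' hyx) ?_
    rw [move_f, move_f, c1.f_p, c1.g_self, hf1 x hx, hf1 y hy, ← hg, h]
    generalize c1.f (c1.p P true) = a
    generalize c1.g P (c1.p P β) = b
    clear * -
    revert a b; decide

lemma exists_cfg [Fintype ι] {m : ℕ} (hm : Even m) (hn : 2 * m + 4 ≤ Fintype.card ι)
    (hno : ¬ ∃ T : Finset ι, T.card = m ∧ ∑ i ∈ T, s i = 0) (j : ℕ) (hj : j ≤ m) :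
    Nonempty (Cfg s j) := by
  induction j with
  | zero => exact ⟨⟨fun R => R.elim0, fun R => R.elim0, 0, fun R => R.elim0, fun R => R.elim0,
      fun R => R.elim0⟩⟩
  | succ j ih =>
    obtain ⟨c⟩ := ih (by omega)
    exact step hm hn (by omega) hno c

lemma exists_sep [FiniteDimensional (ZMod 2) V] (hd : Module.finrank (ZMod 2) V = j + 1)
    (c : Cfg s j) : ∃ c : Cfg s j, c.Sep := by
  have hk : LinearMap.ker (LinearMap.pi c.ψ) ≠ ⊥ := by
    apply LinearMap.ker_ne_bot_of_finrank_lt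
    rw [hd]; simp
  obtain ⟨v0, hv0, hne⟩ := Submodule.exists_mem_ne_zero_of_ne_bot hk
  have hv : ∀ R, c.ψ R v0 = 0 := fun R => congrFun (LinearMap.mem_ker.1 hv0) R
  obtain ⟨θ, hθ⟩ := exists_functional v0 hne
  have hpair : ∀ R,
      (θ ∘ₗ c.rho) (s (c.p R true)) = (θ ∘ₗ c.rho) (s (c.p R false)) := by
    intro R
    simp [c.rho_pair R]
  refine ⟨c.withφ (θ ∘ₗ c.rho) hpair, ?_⟩
  have hφ0 : (θ ∘ₗ c.rho) v0 = 1 := by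
    simp [rho_apply, hv, hθ]
  have hsurj : Function.Surjective ((θ ∘ₗ c.rho).prod (LinearMap.pi c.ψ)) := by
    rintro ⟨a, b⟩
    refine ⟨a • v0 + ∑ R, b R • (s (c.p R true) + s (c.p R false)), ?_⟩
    refine Prod.ext ?_ ?_
    · change (θ ∘ₗ c.rho) (a • v0 + ∑ R, b R • (s (c.p R true) + s (c.p R false))) = a
      rw [map_add, map_sum, map_smul, hφ0]
      have h0 : ∀ R, (θ ∘ₗ c.rho) (b R • (s (c.p R true) + s (c.p R false))) = 0 := by
        intro R
        rw [map_smul, map_add, hpair R, CharTwo.add_self_eq_zero, smul_zero]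
      rw [Finset.sum_congr rfl (fun R _ => h0 R)]
      simp
    · funext Q
      change c.ψ Q (a • v0 + ∑ R, b R • (s (c.p R true) + s (c.p R false))) = b Q
      rw [map_add, map_sum, map_smul, hv]
      have h0 : ∀ R, c.ψ Q (b R • (s (c.p R true) + s (c.p R false))) =
          if Q = R then b R else 0 := by
        intro R
        rw [map_smul, map_add, c.hψ, smul_eq_mul, mul_ite, mul_one, mul_zero]
      rw [Finset.sum_congr rfl (fun R _ => h0 R)]
      simp
  have hinj := (LinearMap.injective_iff_surjective_of_finrank_eq_finrank
    (by rw [hd]; simp [add_comm])).2 hsurj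
  intro v h1 h2
  apply hinj
  rw [map_zero]
  refine Prod.ext h1 ?_
  funext R
  exact h2 R

end
end Cfg

lemma main [Fintype ι] [FiniteDimensional (ZMod 2) V] (s : ι → V) (m : ℕ) (hm : Even m)
    (hd : Module.finrank (ZMod 2) V = m + 1) (hs : ∑ i, s i = 0) (hne : Even (Fintype.card ι))
    (hn : 2 * m + 6 ≤ Fintype.card ι ∨ Fintype.card ι = 2 * m + 4 ∧ 4 ∣ m) :
    ∃ T : Finset ι, T.card = m ∧ ∑ i ∈ T, s i = 0 := by
  by_contra hno
  have hB := Cfg.bad_of_not hno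
  obtain ⟨c0⟩ := Cfg.exists_cfg hm (by omega) hno m le_rfl
  obtain ⟨c, hc⟩ := c0.exists_sep hd
  rcases hn with hn | ⟨hn, h4⟩
  · have h1 := c.card_A
    have h2 := c.AA_add
    have : ∃ ε, 3 ≤ (c.AA ε).card := by
      by_cases h : 3 ≤ (c.AA 0).card
      · exact ⟨0, h⟩
      · exact ⟨1, by omega⟩
    obtain ⟨ε, hε⟩ := this
    exact Cfg.fact4 hB hm hs hne (m + 1) c hc ε hε (by omega)
  · exact Cfg.fact8 hB h4 hs hn c hc

end ZS

theorem zero_sum_subseq_d_odd_small (k d : ℕ) (hk : 0 < k) (hd : Odd d) (hd0 : 0 < d)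
    (hde : Even k → d ≤ 2 * k - 3) (hdo : Odd k → d ≤ 2 * k - 5)
    (S : Multiset (Fin d → ZMod 2))
    (hcard : Multiset.card S = 2 * k + d - 1) (hsum : S.sum = 0) :
    ∃ T ≤ S, Multiset.card T = 2 * k ∧ T.sum = 0 := by
  classical
  obtain ⟨l, rfl⟩ := Quot.exists_rep S
  change (l : Multiset (Fin d → ZMod 2)).card = _ at hcard
  change (l : Multiset (Fin d → ZMod 2)).sum = _ at hsum
  rw [Multiset.coe_card] at hcard
  rw [Multiset.sum_coe] at hsum
  obtain ⟨q, hq⟩ := hd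
  have hs : ∑ i : Fin l.length, l.get i = 0 := by
    rw [← List.sum_ofFn, List.ofFn_get, hsum]
  have hmap : (Finset.univ : Finset (Fin l.length)).val.map l.get = (l : Multiset (Fin d → ZMod 2)) := by
    simp
  obtain ⟨T, hT, hT0⟩ := ZS.main l.get (2 * q) (even_two_mul q) (by simp [hq]) hs
    (by rw [Fintype.card_fin]; exact ⟨k + q, by omega⟩)
    (by
      rw [Fintype.card_fin]
      rcases Nat.even_or_odd k with h | h
      · have h1 := hde h
        obtain ⟨r, hr⟩ := h
        omega
      · have h1 := hdo h
        obtain ⟨r, hr⟩ := h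
        omega)
  refine ⟨(Tᶜ).val.map l.get, ?_, ?_, ?_⟩
  · change _ ≤ (l : Multiset (Fin d → ZMod 2))
    rw [← hmap]
    exact Multiset.map_le_map (Finset.val_le_iff.2 (Finset.subset_univ _))
  · rw [Multiset.card_map, Finset.card_val, Finset.card_compl, Fintype.card_fin, hT]
    omega
  · change ∑ i ∈ Tᶜ, l.get i = 0
    have := Finset.sum_add_sum_compl T l.get
    rw [hT0, hs, zero_add] at this
    exact this
end
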